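/- Let r,s ∈ [1,2] and p,q ∈ [1,+∞) with s ≤ q. Then E(L_r,p) is Borel reducible to E(L_s,q) if and only if p ≤ q and r/p ≥ s/q. -/

import Mathlib

open Filter Topology MeasureTheory
open scoped ENNReal NNReal

noncomputable section

/-- `E` is Borel reducible to `F`: there is a Borel (measurable) map `θ` such that
`E x y ↔ F (θ x) (θ y)` for all `x, y`. -/
def BorelReducible {α β : Type*} [MeasurableSpace α] [MeasurableSpace β]
    (E : α → α → Prop) (F : β → β → Prop) : Prop :=
  ∃ θ : α → β, Measurable θ ∧ ∀ x y, E x y ↔ F (θ x) (θ y)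

/-- The sequence space `ℓ_r` of real sequences with summable `r`-th power. -/
abbrev ellSp (r : ℝ) : Type := lp (fun _ : ℕ => ℝ) (ENNReal.ofReal r)

/-- The Lebesgue space `L_r[0,1]` (with respect to Lebesgue measure on `[0,1]`). -/
abbrev LSp (r : ℝ) : Type :=
  MeasureTheory.Lp ℝ (ENNReal.ofReal r) ((volume : Measure ℝ).restrict (Set.Icc 0 1))

/-- The equivalence relation `E(X,p)` on `X^ℕ`:
`x ~ y` iff `Σ_n ‖x n - y n‖^p < ∞`. -/
def ESum (X : Type*) [NormedAddCommGroup X] (p : ℝ) : (ℕ → X) → (ℕ → X) → Prop :=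
  fun x y => Summable fun n => ‖x n - y n‖ ^ p

noncomputable instance {E : ℕ → Type*} [∀ i, NormedAddCommGroup (E i)] (p : ℝ≥0∞)
    [Fact (1 ≤ p)] : MeasurableSpace (lp E p) := borel _
instance {E : ℕ → Type*} [∀ i, NormedAddCommGroup (E i)] (p : ℝ≥0∞)
    [Fact (1 ≤ p)] : BorelSpace (lp E p) := ⟨rfl⟩

noncomputable instance {α : Type*} [MeasurableSpace α] (μ : Measure α) (p : ℝ≥0∞)
    [Fact (1 ≤ p)] : MeasurableSpace (Lp ℝ p μ) := borel _
instance {α : Type*} [MeasurableSpace α] (μ : Measure α) (p : ℝ≥0∞)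
    [Fact (1 ≤ p)] : BorelSpace (Lp ℝ p μ) := ⟨rfl⟩

instance : Fact (1 ≤ ENNReal.ofReal 2) := ⟨ENNReal.one_le_ofReal.2 one_le_two⟩

open Finset in
lemma sum_compl_range (N : ℕ) (G : Finset ℕ → ℝ) :
    ∑ A ∈ (range N).powerset, G (range N \ A) = ∑ A ∈ (range N).powerset, G A := by
  refine Finset.sum_nbij' (fun A => range N \ A) (fun A => range N \ A) ?_ ?_ ?_ ?_ ?_
  · intro A hA; simp
  · intro A hA; simp
  · intro A hA; simp only [mem_powerset] at hA; simpa using hA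
  · intro A hA; simp only [mem_powerset] at hA; simpa using hA
  · intro A hA; rfl

open Finset in
lemma sum_flip_range (N j : ℕ) (hj : j ∈ range N) (G : Finset ℕ → ℝ) :
    ∑ A ∈ (range N).powerset, G (symmDiff A {j}) = ∑ A ∈ (range N).powerset, G A := by
  have key : ∀ A, A ⊆ range N → symmDiff A {j} ⊆ range N := by
    intro A hA x hx
    rw [Finset.mem_symmDiff] at hx
    rcases hx with ⟨h, _⟩ | ⟨h, _⟩
    · exact hA h
    · rw [Finset.mem_singleton] at h; rw [h]; exact hj
  refine Finset.sum_nbij' (fun A => symmDiff A {j}) (fun A => symmDiff A {j}) ?_ ?_ ?_ ?_ ?_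
  · intro A hA; simp only [mem_powerset] at *; exact key A hA
  · intro A hA; simp only [mem_powerset] at *; exact key A hA
  · intro A hA; simp
  · intro A hA; simp
  · intro A hA; rfl

open Finset in
lemma enflo_two (N : ℕ) : ∀ F : Finset ℕ → ℝ,
    ∑ A ∈ (range N).powerset, (F A - F (range N \ A)) ^ 2 ≤
      ∑ A ∈ (range N).powerset, ∑ j ∈ range N, (F A - F (symmDiff A {j})) ^ 2 := by
  induction N with
  | zero => intro F; simp
  | succ N ih =>
    intro F
    have h1 := ih F
    have h2 := ih (fun A => F (insert N A))
    have hN : N ∉ range N := by simp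
    rw [Finset.range_add_one, Finset.sum_powerset_insert hN, Finset.sum_powerset_insert hN]
    have c1 : ∀ A ∈ (range N).powerset, insert N (range N) \ A = insert N (range N \ A) := by
      intro A hA
      rw [mem_powerset] at hA
      exact Finset.insert_sdiff_of_notMem _ (fun h => hN (hA h))
    have c2 : ∀ A ∈ (range N).powerset, insert N (range N) \ insert N A = range N \ A := by
      intro A hA
      rw [mem_powerset] at hA
      ext x; simp only [Finset.mem_sdiff, Finset.mem_insert, Finset.mem_range]
      constructor
      · rintro ⟨h1, h2⟩; tauto
      · rintro ⟨h1, h2⟩; refine ⟨Or.inr h1, ?_⟩; rintro (rfl | h)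
        · omega
        · exact h2 h
    have e1 : ∀ A ∈ (range N).powerset, symmDiff A {N} = insert N A := by
      intro A hA
      rw [mem_powerset] at hA
      have : N ∉ A := fun h => hN (hA h)
      ext x; simp only [Finset.mem_symmDiff, Finset.mem_singleton, Finset.mem_insert]
      constructor
      · tauto
      · rintro (rfl | h)
        · tauto
        · left; exact ⟨h, fun h' => this (h' ▸ h)⟩
    have e2 : ∀ A ∈ (range N).powerset, symmDiff (insert N A) {N} = A := by
      intro A hA; rw [← e1 A hA, symmDiff_assoc]; simp
    have e3 : ∀ A ∈ (range N).powerset, ∀ j ∈ range N,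
        symmDiff (insert N A) {j} = insert N (symmDiff A {j}) := by
      intro A hA j hj
      have hjN : j ≠ N := by rintro rfl; simp at hj
      ext x; simp only [Finset.mem_symmDiff, Finset.mem_singleton, Finset.mem_insert]
      constructor
      · tauto
      · rintro (rfl | h)
        · left; exact ⟨Or.inl rfl, fun h => hjN h.symm⟩
        · rcases h with h | h
          · tauto
          · right; refine ⟨h.1, ?_⟩; rintro (h' | h')
            · exact hjN (h.1 ▸ h')
            · exact h.2 h'
    have hL : ∑ A ∈ (range N).powerset, (F A - F (insert N (range N) \ A)) ^ 2 +
        ∑ A ∈ (range N).powerset, (F (insert N A) - F (insert N (range N) \ insert N A)) ^ 2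
        ≤ ∑ A ∈ (range N).powerset, ((F A - F (insert N A))^2 +
          (F (insert N A) - F (insert N (range N \ A)))^2 +
          (F (range N \ A) - F (insert N (range N \ A)))^2 + (F A - F (range N \ A))^2) := by
      rw [← Finset.sum_add_distrib]
      refine Finset.sum_le_sum fun A hA => ?_
      rw [c1 A hA, c2 A hA]
      nlinarith [sq_nonneg (F A - F (insert N A) + F (insert N (range N \ A)) - F (range N \ A))]
    refine hL.trans ?_
    have hr := sum_compl_range N (fun A => (F A - F (insert N A))^2)
    simp only [Finset.sum_add_distrib]
    have R1 : ∑ A ∈ (range N).powerset, ∑ j ∈ insert N (range N), (F A - F (symmDiff A {j})) ^ 2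
        = ∑ A ∈ (range N).powerset, (F A - F (insert N A))^2 +
          ∑ A ∈ (range N).powerset, ∑ j ∈ range N, (F A - F (symmDiff A {j})) ^ 2 := by
      rw [← Finset.sum_add_distrib]
      refine Finset.sum_congr rfl fun A hA => ?_
      rw [Finset.sum_insert hN, e1 A hA]
    have R2 : ∑ A ∈ (range N).powerset, ∑ j ∈ insert N (range N),
          (F (insert N A) - F (symmDiff (insert N A) {j})) ^ 2
        = ∑ A ∈ (range N).powerset, (F A - F (insert N A))^2 +
          ∑ A ∈ (range N).powerset, ∑ j ∈ range N,
            (F (insert N A) - F (insert N (symmDiff A {j}))) ^ 2 := by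
      rw [← Finset.sum_add_distrib]
      refine Finset.sum_congr rfl fun A hA => ?_
      rw [Finset.sum_insert hN, e2 A hA]
      congr 1
      · ring
      · exact Finset.sum_congr rfl fun j hj => by rw [e3 A hA j hj]
    rw [R1, R2]
    linarith

noncomputable def spow (k a : ℝ) : ℝ := SignType.sign a * |a| ^ k

lemma spow_of_nonneg {k a : ℝ} (hk : 0 < k) (ha : 0 ≤ a) : spow k a = a ^ k := by
  unfold spow
  rcases ha.eq_or_lt with rfl | h
  · simp [Real.zero_rpow hk.ne']
  · simp [sign_pos h, abs_of_pos h]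

lemma spow_neg (k a : ℝ) : spow k (-a) = - spow k a := by
  unfold spow; simp [Left.sign_neg]

lemma spow_sub_le_aux {k a b : ℝ} (hk : 0 < k) (hk1 : k ≤ 1) (hb : 0 ≤ b) (hab : b ≤ a) :
    |spow k a - spow k b| ≤ 2 * |a - b| ^ k := by
  rw [spow_of_nonneg hk hb, spow_of_nonneg hk (hb.trans hab)]
  have h := Real.rpow_add_le_add_rpow (sub_nonneg.2 hab) hb hk.le hk1
  rw [sub_add_cancel] at h
  have h2 := Real.rpow_le_rpow hb hab hk.le
  have h3 := Real.rpow_nonneg (sub_nonneg.2 hab) k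
  rw [abs_of_nonneg (by linarith), abs_of_nonneg (by linarith : 0 ≤ a - b)]
  linarith

lemma spow_sub_le_aux2 {k a b : ℝ} (hk : 0 < k) (hb : b ≤ 0) (ha : 0 ≤ a) :
    |spow k a - spow k b| ≤ 2 * |a - b| ^ k := by
  have : spow k b = - ((-b) ^ k) := by
    rw [← spow_of_nonneg hk (by linarith), spow_neg, neg_neg]
  rw [this, spow_of_nonneg hk ha, abs_of_nonneg (by linarith : 0 ≤ a - b)]
  have h1 := Real.rpow_le_rpow ha (by linarith : a ≤ a - b) hk.le
  have h2 := Real.rpow_le_rpow (by linarith : 0 ≤ -b) (by linarith : -b ≤ a - b) hk.le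
  have h3 := Real.rpow_nonneg ha k
  have h4 := Real.rpow_nonneg (by linarith : 0 ≤ -b) k
  rw [abs_of_nonneg (by linarith)]
  linarith

lemma spow_sub_le {k : ℝ} (hk : 0 < k) (hk1 : k ≤ 1) (a b : ℝ) :
    |spow k a - spow k b| ≤ 2 * |a - b| ^ k := by
  wlog hab : b ≤ a generalizing a b
  · rw [abs_sub_comm, abs_sub_comm a b]; exact this b a (by linarith)
  rcases le_total 0 b with hb | hb
  · exact spow_sub_le_aux hk hk1 hb hab
  · rcases le_total 0 a with ha | ha
    · exact spow_sub_le_aux2 hk hb ha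
    · have := spow_sub_le_aux hk hk1 (by linarith : 0 ≤ -a) (by linarith : -a ≤ -b)
      rw [spow_neg, spow_neg] at this
      rw [neg_sub_neg, neg_sub_neg] at this
      exact this

lemma spow_sq {s : ℝ} (hs : 0 < s) (a : ℝ) : (spow (s/2) a) ^ 2 = |a| ^ s := by
  have : (|a| ^ (s/2)) ^ 2 = |a| ^ s := by
    rw [← Real.rpow_natCast, ← Real.rpow_mul (abs_nonneg _)]; congr 1; push_cast; ring
  rcases lt_trichotomy a 0 with h | h | h
  · unfold spow; simp [sign_neg h, this]
  · subst h; simp [spow, Real.zero_rpow hs.ne']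
  · unfold spow; simp [sign_pos h, this]

lemma norm_add_rpow_le {E : Type*} [SeminormedAddCommGroup E] {q : ℝ} (hq : 1 ≤ q) (x y : E) :
    ‖x + y‖ ^ q ≤ 2 ^ (q-1) * (‖x‖ ^ q + ‖y‖ ^ q) := by
  refine (Real.rpow_le_rpow (norm_nonneg _) (norm_add_le x y) (by linarith)).trans ?_
  have := NNReal.rpow_add_le_mul_rpow_add_rpow ‖x‖₊ ‖y‖₊ hq
  exact_mod_cast this

open Finset in
lemma compl_symmDiff_range {N j : ℕ} (hj : j ∈ range N) {A : Finset ℕ} (hA : A ∈ (range N).powerset) :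
    range N \ symmDiff A {j} = symmDiff (range N \ A) {j} := by
  rw [Finset.mem_powerset] at hA
  ext x
  simp only [Finset.mem_sdiff, Finset.mem_symmDiff, Finset.mem_singleton]
  by_cases hx : x = j
  · subst hx; tauto
  · tauto

open Finset in
lemma edge_refl {E : Type*} [SeminormedAddCommGroup E] {q : ℝ} (hq : 1 ≤ q)
    (N : ℕ) (f : Finset ℕ → E) :
    ∑ A ∈ (range N).powerset, ∑ j ∈ range N,
      ‖(f A - f (range N \ A)) - (f (symmDiff A {j}) - f (range N \ symmDiff A {j}))‖ ^ q ≤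
    2 ^ q * ∑ A ∈ (range N).powerset, ∑ j ∈ range N, ‖f A - f (symmDiff A {j})‖ ^ q := by
  have h : ∀ A ∈ (range N).powerset, ∑ j ∈ range N,
      ‖(f A - f (range N \ A)) - (f (symmDiff A {j}) - f (range N \ symmDiff A {j}))‖ ^ q ≤
      2 ^ (q-1) * (∑ j ∈ range N, ‖f A - f (symmDiff A {j})‖ ^ q +
        ∑ j ∈ range N, ‖f (range N \ A) - f (symmDiff (range N \ A) {j})‖ ^ q) := by
    intro A hA
    rw [← Finset.sum_add_distrib, Finset.mul_sum]
    refine Finset.sum_le_sum fun j hj => ?_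
    rw [compl_symmDiff_range hj hA]
    have := norm_add_rpow_le hq (f A - f (symmDiff A {j}))
      (-(f (range N \ A) - f (symmDiff (range N \ A) {j})))
    rw [norm_neg] at this
    refine le_trans (le_of_eq ?_) this
    congr 2
    abel
  refine (Finset.sum_le_sum h).trans ?_
  rw [← Finset.mul_sum, Finset.sum_add_distrib,
    sum_compl_range N (fun A => ∑ j ∈ range N, ‖f A - f (symmDiff A {j})‖ ^ q)]
  have h2 : (2:ℝ) ^ q = 2 ^ (q-1) * 2 := by
    rw [Real.rpow_sub_one (by norm_num)]; field_simp
  rw [h2]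
  linarith

open Finset in
lemma enflo_real {s : ℝ} (hs : 1 ≤ s) (hs2 : s ≤ 2) (N : ℕ) (f : Finset ℕ → ℝ) :
    ∑ A ∈ (range N).powerset, |f A - f (range N \ A)| ^ s ≤
      4 * ∑ A ∈ (range N).powerset, ∑ j ∈ range N, |f A - f (symmDiff A {j})| ^ s := by
  set h : Finset ℕ → ℝ := fun A => f A - f (range N \ A) with hh
  have h0 := enflo_two N (fun A => spow (s/2) (h A))
  have h1 : ∑ A ∈ (range N).powerset, (spow (s/2) (h A) - spow (s/2) (h (range N \ A)))^2
      = 4 * ∑ A ∈ (range N).powerset, |f A - f (range N \ A)| ^ s := by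
    rw [Finset.mul_sum]
    refine Finset.sum_congr rfl fun A hA => ?_
    rw [Finset.mem_powerset] at hA
    have : h (range N \ A) = - h A := by
      simp only [hh]; rw [Finset.sdiff_sdiff_eq_self hA]; ring
    rw [this, spow_neg]
    have := spow_sq (by linarith : 0 < s) (h A)
    rw [← this]; ring
  have h2 : ∑ A ∈ (range N).powerset, ∑ j ∈ range N,
      (spow (s/2) (h A) - spow (s/2) (h (symmDiff A {j})))^2 ≤
      ∑ A ∈ (range N).powerset, ∑ j ∈ range N, 4 * |h A - h (symmDiff A {j})| ^ s := by
    refine Finset.sum_le_sum fun A hA => Finset.sum_le_sum fun j hj => ?_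
    have := spow_sub_le (by linarith : 0 < s/2) (by linarith) (h A) (h (symmDiff A {j}))
    rw [← sq_abs]
    refine (pow_le_pow_left₀ (abs_nonneg _) this 2).trans (le_of_eq ?_)
    rw [mul_pow, ← Real.rpow_natCast (_ ^ (s/2)), ← Real.rpow_mul (abs_nonneg _)]
    congr 1
    · norm_num
    · congr 1; push_cast; ring
  have h3 := edge_refl hs N f
  simp only [Real.norm_eq_abs] at h3
  have h4 : (2:ℝ) ^ s ≤ 4 := by
    calc (2:ℝ)^s ≤ 2 ^ (2:ℝ) := Real.rpow_le_rpow_of_exponent_le (by norm_num) hs2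
      _ = 4 := by norm_num
  simp only [← Finset.mul_sum] at h2
  have h5 : 0 ≤ ∑ A ∈ (range N).powerset, ∑ j ∈ range N, |f A - f (symmDiff A {j})| ^ s := by
    positivity
  have h6 := mul_le_mul_of_nonneg_right h4 h5
  rw [h1] at h0
  have h7 := h0.trans h2
  simp only [hh] at h7
  linarith

lemma LSp_norm_rpow {s : ℝ} (hs : 1 ≤ s) [Fact (1 ≤ ENNReal.ofReal s)] {α : Type*}
    [MeasurableSpace α] {μ : Measure α} (f : Lp ℝ (ENNReal.ofReal s) μ) :
    ENNReal.ofReal (‖f‖ ^ s) = ∫⁻ x, ENNReal.ofReal (|f x| ^ s) ∂μ := by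
  have h0 : ENNReal.ofReal s ≠ 0 := by simp; linarith
  have hs0 : 0 < s := by linarith
  rw [← ENNReal.ofReal_rpow_of_nonneg (norm_nonneg _) hs0.le, ofReal_norm, Lp.enorm_def,
    eLpNorm_eq_lintegral_rpow_enorm_toReal h0 (by simp), ENNReal.toReal_ofReal hs0.le,
    ← ENNReal.rpow_mul, one_div, inv_mul_cancel₀ hs0.ne', ENNReal.rpow_one]
  refine lintegral_congr fun x => ?_
  rw [← ENNReal.ofReal_rpow_of_nonneg (abs_nonneg _) hs0.le, ← Real.norm_eq_abs, ofReal_norm]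

open Finset in
lemma enflo_Lp {s : ℝ} (hs : 1 ≤ s) (hs2 : s ≤ 2) [Fact (1 ≤ ENNReal.ofReal s)] {α : Type*}
    [MeasurableSpace α] {μ : Measure α} (N : ℕ) (f : Finset ℕ → Lp ℝ (ENNReal.ofReal s) μ) :
    ∑ A ∈ (range N).powerset, ‖f A - f (range N \ A)‖ ^ s ≤
      4 * ∑ A ∈ (range N).powerset, ∑ j ∈ range N, ‖f A - f (symmDiff A {j})‖ ^ s := by
  rw [← ENNReal.ofReal_le_ofReal_iff (by positivity), ENNReal.ofReal_mul (by norm_num),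
    ENNReal.ofReal_sum_of_nonneg (fun _ _ => by positivity),
    ENNReal.ofReal_sum_of_nonneg (fun _ _ => by positivity)]
  simp_rw [ENNReal.ofReal_sum_of_nonneg (fun j (_ : j ∈ range N) =>
    Real.rpow_nonneg (norm_nonneg _) s), LSp_norm_rpow hs]
  have hm : ∀ A B, Measurable fun x => ENNReal.ofReal (|(f A - f B : Lp ℝ (ENNReal.ofReal s) μ) x| ^ s) := by
    intro A B
    have := (Lp.stronglyMeasurable (f A - f B)).measurable
    fun_prop
  rw [← lintegral_finsetSum _ (fun A _ => hm _ _)]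
  simp_rw [← lintegral_finsetSum _ (fun j (_ : j ∈ range N) => hm _ (symmDiff _ {j}))]
  rw [← lintegral_finsetSum _ (fun A _ => Finset.measurable_sum _ fun j _ => hm _ _),
    ← lintegral_const_mul _ (Finset.measurable_sum _ fun A _ => Finset.measurable_sum _ fun j _ => hm _ _)]
  refine lintegral_mono_ae ?_
  have hae : ∀ᵐ x ∂μ, ∀ A B, (f A - f B : Lp ℝ (ENNReal.ofReal s) μ) x = f A x - f B x := by
    rw [ae_all_iff]; intro A; rw [ae_all_iff]; intro B
    filter_upwards [Lp.coeFn_sub (f A) (f B)] with x hx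
    rw [hx]; rfl
  filter_upwards [hae] with x hx
  have := enflo_real hs hs2 N (fun A => f A x)
  rw [← ENNReal.ofReal_le_ofReal_iff (by positivity), ENNReal.ofReal_mul (by norm_num),
    ENNReal.ofReal_sum_of_nonneg (fun _ _ => by positivity),
    ENNReal.ofReal_sum_of_nonneg (fun _ _ => by positivity)] at this
  simp_rw [ENNReal.ofReal_sum_of_nonneg (fun j (_ : j ∈ range N) =>
    Real.rpow_nonneg (abs_nonneg _) s)] at this
  simpa only [hx] using this

lemma one_sub_rpow_le {κ t : ℝ} (hκ : 0 ≤ κ) (ht : 0 ≤ t) (ht1 : t ≤ 1) :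
    1 - t ^ κ ≤ (1 + κ) * (1 - t) := by
  rcases le_total 1 κ with h | h
  · have := one_add_mul_self_le_rpow_one_add (by linarith : -1 ≤ t - 1) h
    rw [add_sub_cancel] at this
    nlinarith
  · have : t ^ (1:ℝ) ≤ t ^ κ := by
      rcases ht.eq_or_lt with rfl | h0
      · rw [Real.zero_rpow (by norm_num)]; positivity
      · exact Real.rpow_le_rpow_of_exponent_ge h0 ht1 h
    rw [Real.rpow_one] at this
    nlinarith

lemma rpow_sub_mul_le {κ a b : ℝ} (hκ : 0 ≤ κ) (hb : 0 ≤ b) (hab : b ≤ a) :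
    (a ^ κ - b ^ κ) * b ≤ (1 + κ) * a ^ κ * (a - b) := by
  rcases (hb.trans hab).eq_or_lt with h | h
  · subst h
    have : b = 0 := le_antisymm hab hb
    subst this; simp
  · have h1 := one_sub_rpow_le hκ (div_nonneg hb h.le) ((div_le_one h).2 hab)
    rw [Real.div_rpow hb h.le] at h1
    have ha : 0 < a ^ κ := Real.rpow_pos_of_pos h _
    have h2 : (a ^ κ - b ^ κ) * a ≤ (1 + κ) * a ^ κ * (a - b) := by
      have h3 := mul_le_mul_of_nonneg_left h1 (mul_pos ha h).le
      have e1 : a ^ κ * a * (1 - b ^ κ / a ^ κ) = (a ^ κ - b ^ κ) * a := by field_simp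
      have e2 : a ^ κ * a * ((1 + κ) * (1 - b / a)) = (1 + κ) * a ^ κ * (a - b) := by field_simp
      rwa [e1, e2] at h3
    have h4 : 0 ≤ a ^ κ - b ^ κ := sub_nonneg.2 (Real.rpow_le_rpow hb hab hκ)
    exact (mul_le_mul_of_nonneg_left hab h4).trans h2

lemma radial_lip {E : Type*} [NormedAddCommGroup E] [NormedSpace ℝ E] {κ : ℝ} (hκ : 0 ≤ κ)
    (v w : E) : ‖(‖v‖ ^ κ) • v - (‖w‖ ^ κ) • w‖ ≤ (2 + κ) * max ‖v‖ ‖w‖ ^ κ * ‖v - w‖ := by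
  wlog h : ‖w‖ ≤ ‖v‖ generalizing v w
  · have := this w v (by linarith)
    rwa [norm_sub_rev, max_comm, norm_sub_rev w v] at this
  rw [max_eq_left h]
  have e : (‖v‖ ^ κ) • v - (‖w‖ ^ κ) • w = (‖v‖ ^ κ) • (v - w) + (‖v‖ ^ κ - ‖w‖ ^ κ) • w := by
    module
  have h4 : 0 ≤ ‖v‖ ^ κ - ‖w‖ ^ κ := sub_nonneg.2 (Real.rpow_le_rpow (norm_nonneg _) h hκ)
  rw [e]
  refine (norm_add_le _ _).trans ?_
  rw [norm_smul, norm_smul, Real.norm_of_nonneg h4, Real.norm_of_nonneg (by positivity)]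
  have h1 := rpow_sub_mul_le hκ (norm_nonneg w) h
  have h2 : ‖v‖ - ‖w‖ ≤ ‖v - w‖ := norm_sub_norm_le v w
  have h3 := mul_le_mul_of_nonneg_left h2 (by positivity : 0 ≤ (1 + κ) * ‖v‖ ^ κ)
  linarith

lemma young_aux {s q a B : ℝ} (hs : 0 < s) (hsq : s ≤ q) (ha : 0 ≤ a) (hB : 0 ≤ B) :
    a ^ (q - s) * B ≤ 1/2 * a ^ q + 2 ^ (q/s - 1) * B ^ (q/s) := by
  have hq : 0 < q := by linarith
  rcases le_total B (a ^ s / 2) with h | h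
  · have h1 := mul_le_mul_of_nonneg_left h (Real.rpow_nonneg ha (q-s))
    have h2 : a ^ (q - s) * (a ^ s / 2) = 1/2 * a ^ q := by
      have : a ^ q = a ^ (q - s) * a ^ s := by
        rw [← Real.rpow_add' ha (by simpa using hq.ne')]; congr 1; ring
      rw [this]; ring
    have : 0 ≤ 2 ^ (q/s - 1) * B ^ (q/s) := by positivity
    linarith
  · have h1 : a ^ s ≤ 2 * B := by linarith
    have hk : 0 ≤ q/s - 1 := by rw [sub_nonneg, one_le_div hs]; exact hsq
    have h2 : a ^ (q - s) ≤ 2 ^ (q/s - 1) * B ^ (q/s - 1) := by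
      rw [← Real.mul_rpow (by norm_num) hB]
      refine le_trans (le_of_eq ?_) (Real.rpow_le_rpow (by positivity) h1 hk)
      rw [← Real.rpow_mul ha]; congr 1; field_simp
    have h3 := mul_le_mul_of_nonneg_right h2 hB
    have h4 : B ^ (q/s) = B ^ (q/s - 1) * B := by
      rw [← Real.rpow_add_one' hB (by rw [sub_add_cancel]; positivity), sub_add_cancel]
    have : 0 ≤ 1/2 * a ^ q := by positivity
    rw [h4]; linarith

open Finset in
lemma enflo_q {s q : ℝ} (hs : 1 ≤ s) (hs2 : s ≤ 2) (hsq : s ≤ q) [Fact (1 ≤ ENNReal.ofReal s)]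
    {α : Type*} [MeasurableSpace α] {μ : Measure α} :
    ∃ K > 0, ∀ (N : ℕ) (f : Finset ℕ → Lp ℝ (ENNReal.ofReal s) μ),
    ∑ A ∈ (range N).powerset, ‖f A - f (range N \ A)‖ ^ q ≤
      K * (N:ℝ) ^ (q/s - 1) * ∑ A ∈ (range N).powerset, ∑ j ∈ range N, ‖f A - f (symmDiff A {j})‖ ^ q := by
  have hs0 : 0 < s := by linarith
  set κ := q/s - 1 with hκd
  have hκ : 0 ≤ κ := by rw [hκd, sub_nonneg, one_le_div hs0]; exact hsq
  set C1 : ℝ := 8 * (2 + κ) ^ s with hC1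
  have hC1p : 0 < C1 := by positivity
  refine ⟨2 * 2 ^ κ * C1 ^ (q/s) * 2 ^ q, by positivity, fun N f => ?_⟩
  set h : Finset ℕ → Lp ℝ (ENNReal.ofReal s) μ := fun A => f A - f (range N \ A) with hh
  set D : Finset ℕ → ℕ → ℝ := fun A j => ‖h A - h (symmDiff A {j})‖ with hD
  have h0 := enflo_Lp hs hs2 N (fun A => (‖h A‖ ^ κ) • h A)
  have hks : κ * s = q - s := by rw [hκd]; field_simp
  have h1 : ∑ A ∈ (range N).powerset, ‖h A‖ ^ q ≤
      ∑ A ∈ (range N).powerset, ‖(‖h A‖ ^ κ) • h A - (‖h (range N \ A)‖ ^ κ) • h (range N \ A)‖ ^ s := by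
    refine Finset.sum_le_sum fun A hA => ?_
    rw [Finset.mem_powerset] at hA
    have : h (range N \ A) = - h A := by
      simp only [hh]; rw [Finset.sdiff_sdiff_eq_self hA]; abel
    rw [this, norm_neg, smul_neg, sub_neg_eq_add, ← two_smul ℝ, norm_smul, norm_smul,
      Real.norm_of_nonneg (by positivity : 0 ≤ ‖h A‖ ^ κ), Real.norm_of_nonneg (by norm_num : (0:ℝ) ≤ 2),
      Real.mul_rpow (by norm_num) (by positivity), Real.mul_rpow (by positivity) (by positivity),
      ← Real.rpow_mul (norm_nonneg _), hks, ← Real.rpow_add' (norm_nonneg _) (by rw [sub_add_cancel]; linarith),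
      sub_add_cancel]
    have : (1:ℝ) ≤ 2 ^ s := Real.one_le_rpow (by norm_num) hs0.le
    nlinarith [Real.rpow_nonneg (norm_nonneg (h A)) q]
  have h2 : ∑ A ∈ (range N).powerset, ∑ j ∈ range N,
      ‖(‖h A‖ ^ κ) • h A - (‖h (symmDiff A {j})‖ ^ κ) • h (symmDiff A {j})‖ ^ s ≤
      ∑ A ∈ (range N).powerset, ∑ j ∈ range N, (2 + κ) ^ s *
        (‖h A‖ ^ (q - s) * D A j ^ s + ‖h (symmDiff A {j})‖ ^ (q - s) * D (symmDiff A {j}) j ^ s) := by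
    refine Finset.sum_le_sum fun A hA => Finset.sum_le_sum fun j hj => ?_
    have e1 : D (symmDiff A {j}) j = D A j := by
      simp only [hD]; rw [symmDiff_assoc, symmDiff_self, symmDiff_bot, norm_sub_rev]
    rw [e1]
    refine (Real.rpow_le_rpow (norm_nonneg _) (radial_lip hκ _ _) hs0.le).trans ?_
    rw [Real.mul_rpow (by positivity) (by positivity), Real.mul_rpow (by positivity) (by positivity),
      ← Real.rpow_mul (by positivity), hks, mul_assoc, ← add_mul]
    gcongr
    rcases max_choice ‖h A‖ ‖h (symmDiff A {j})‖ with hm | hm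
    · rw [hm]; have := Real.rpow_nonneg (norm_nonneg (h (symmDiff A {j}))) (q-s); linarith
    · rw [hm]; have := Real.rpow_nonneg (norm_nonneg (h A)) (q-s); linarith
  have h3 : ∑ A ∈ (range N).powerset, ∑ j ∈ range N, (2 + κ) ^ s *
        (‖h A‖ ^ (q - s) * D A j ^ s + ‖h (symmDiff A {j})‖ ^ (q - s) * D (symmDiff A {j}) j ^ s)
      = (2 + κ) ^ s * (2 * ∑ A ∈ (range N).powerset, ∑ j ∈ range N, ‖h A‖ ^ (q - s) * D A j ^ s) := by
    simp_rw [← Finset.mul_sum, Finset.sum_add_distrib]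
    have : ∑ A ∈ (range N).powerset, ∑ j ∈ range N, ‖h (symmDiff A {j})‖ ^ (q - s) * D (symmDiff A {j}) j ^ s
        = ∑ A ∈ (range N).powerset, ∑ j ∈ range N, ‖h A‖ ^ (q - s) * D A j ^ s := by
      rw [Finset.sum_comm, Finset.sum_comm (s := (range N).powerset)]
      refine Finset.sum_congr rfl fun j hj => ?_
      exact sum_flip_range N j hj (fun A => ‖h A‖ ^ (q - s) * D A j ^ s)
    rw [this]; simp_rw [← Finset.mul_sum]; rw [two_mul]
  have h4 : ∑ A ∈ (range N).powerset, ‖h A‖ ^ q ≤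
      ∑ A ∈ (range N).powerset, ‖h A‖ ^ (q - s) * (C1 * ∑ j ∈ range N, D A j ^ s) := by
    refine h1.trans (h0.trans ?_)
    refine (mul_le_mul_of_nonneg_left h2 (by norm_num)).trans (le_of_eq ?_)
    rw [h3, hC1]
    simp_rw [Finset.mul_sum]
    refine Finset.sum_congr rfl fun A _ => Finset.sum_congr rfl fun j _ => ?_
    ring
  have h5 : ∀ A, ‖h A‖ ^ (q - s) * (C1 * ∑ j ∈ range N, D A j ^ s) ≤
      1/2 * ‖h A‖ ^ q + 2 ^ κ * C1 ^ (q/s) * (N:ℝ) ^ κ * ∑ j ∈ range N, D A j ^ q := by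
    intro A
    refine (young_aux hs0 hsq (norm_nonneg _) (by positivity)).trans ?_
    have h6 := Real.rpow_sum_le_const_mul_sum_rpow_of_nonneg (s := range N) (f := fun j => D A j ^ s)
      (p := q/s) (by rw [one_le_div hs0]; exact hsq) (fun j _ => by positivity)
    rw [Finset.card_range] at h6
    have h7 : ∀ j, (D A j ^ s) ^ (q/s) = D A j ^ q := by
      intro j; rw [← Real.rpow_mul (norm_nonneg _)]; congr 1; field_simp
    simp_rw [h7] at h6
    rw [Real.mul_rpow hC1p.le (by positivity)]
    have := mul_le_mul_of_nonneg_left h6 (by positivity : 0 ≤ 2 ^ κ * C1 ^ (q/s))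
    rw [← hκd] at this ⊢
    linarith
  have h8 := h4.trans (Finset.sum_le_sum fun A _ => h5 A)
  rw [Finset.sum_add_distrib, ← Finset.mul_sum, ← Finset.mul_sum] at h8
  have h9 := edge_refl (hs.trans hsq) N f
  have h10 : ∑ A ∈ (range N).powerset, ‖h A‖ ^ q ≤ 2 * (2 ^ κ * C1 ^ (q/s) * (N:ℝ) ^ κ *
      ∑ A ∈ (range N).powerset, ∑ j ∈ range N, D A j ^ q) := by linarith
  refine h10.trans ?_
  have := mul_le_mul_of_nonneg_left h9 (by positivity : 0 ≤ 2 * (2 ^ κ * C1 ^ (q/s) * (N:ℝ) ^ κ))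
  refine le_trans (le_of_eq ?_) (this.trans (le_of_eq ?_)) <;> ring

lemma exists_residual_open {Z J : Type*} [TopologicalSpace Z] [MeasurableSpace Z] [BorelSpace Z]
    [Countable J] (F : J → Set Z) (hF : ∀ j, MeasurableSet (F j)) :
    ∃ C ∈ residual Z, ∃ U : J → Set Z, (∀ j, IsOpen (U j)) ∧ ∀ x ∈ C, ∀ j, x ∈ F j ↔ x ∈ U j := by
  choose U hU hFU using fun j => (hF j).residualEq_isOpen
  refine ⟨{x | ∀ j, x ∈ F j ↔ x ∈ U j}, ?_, U, hU, fun x hx => hx⟩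
  have : ∀ j, ∀ᶠ x in residual Z, x ∈ F j ↔ x ∈ U j := fun j => by
    filter_upwards [hFU j] with x hx
    exact iff_of_eq hx
  exact (eventually_countable_forall.2 this)

/-- the finite set of modifications -/
noncomputable def gam (Γ : Finset (ℕ →₀ ℤ)) (N i : ℕ) : Finset (ℕ →₀ ℤ) :=
  (Γ ×ˢ Finset.Icc (-(i:ℤ)) i).image fun z => z.1 + Finsupp.single N z.2

noncomputable def tl {Z Y : Type*} [NormedAddCommGroup Y] (q : ℝ) (G : Z → ℕ → Y) (l : ℕ)
    (x y : Z) : ℝ≥0∞ := ∑' m, ‖G x (m + l) - G y (m + l)‖ₑ ^ q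

section
variable {Y : Type*} [NormedAddCommGroup Y] [MeasurableSpace Y] [BorelSpace Y]
  [SecondCountableTopology Y]

lemma tendsto_tl {Z : Type*} {q : ℝ} (hq : 1 ≤ q) (G : Z → ℕ → Y) (x y : Z)
    (h : Summable fun m => ‖G x m - G y m‖ ^ q) : Tendsto (fun l => tl q G l x y) atTop (𝓝 0) := by
  refine ENNReal.tendsto_sum_nat_add (fun m => ‖G x m - G y m‖ₑ ^ q) ?_
  have : (fun m => ‖G x m - G y m‖ₑ ^ q) = fun m => ENNReal.ofReal (‖G x m - G y m‖ ^ q) := by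
    funext m
    rw [← ENNReal.ofReal_rpow_of_nonneg (norm_nonneg _) (by linarith), ofReal_norm]
  rw [this]
  exact h.tsum_ofReal_ne_top

lemma measurable_tl {Z : Type*} [MeasurableSpace Z] (q : ℝ) (G : Z → ℕ → Y) (hG : Measurable G)
    (l : ℕ) {f g : Z → Z} (hf : Measurable f) (hg : Measurable g) :
    Measurable fun x => tl q G l (f x) (g x) := by
  unfold tl
  refine Measurable.tsum fun m => ?_
  have h1 : Measurable fun x => G (f x) (m + l) := (measurable_pi_apply _).comp (hG.comp hf)
  have h2 : Measurable fun x => G (g x) (m + l) := (measurable_pi_apply _).comp (hG.comp hg)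
  exact ((h1.sub h2).enorm).pow_const q

lemma fusion_generic {q : ℝ} (hq : 1 ≤ q) (G : (ℕ → ℤ) → ℕ → Y) (hG : Measurable G)
    (hfin : ∀ x y : ℕ → ℤ, (∀ᶠ n in atTop, x n = y n) → Summable fun m => ‖G x m - G y m‖ ^ q) :
    ∃ O : ℕ → Set (ℕ → ℤ), ∀ (i : ℕ) (b : ℕ → ℤ) (N : ℕ) (Γ : Finset (ℕ →₀ ℤ)) (l : ℕ),
      ∃ (b' : ℕ → ℤ) (N' : ℕ) (l' : ℕ), N < N' ∧ l < l' ∧ (∀ k < N, b' k = b k) ∧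
      (∀ x ∈ PiNat.cylinder b' N', ∀ γ ∈ Γ, x + ⇑γ ∈ O i) ∧
      (∀ x ∈ PiNat.cylinder b' N', x ∈ (⋂ j, O j) → ∀ γ ∈ Γ, ∀ γ' ∈ Γ,
        tl q G l' (x + ⇑γ) (x + ⇑γ') ≤ (2⁻¹ : ℝ≥0∞) ^ i) ∧
      (∀ x ∈ PiNat.cylinder b' N', x ∈ (⋂ j, O j) → ∀ x' ∈ PiNat.cylinder b' N', x' ∈ (⋂ j, O j) →
        ∀ γ ∈ Γ, ∀ m < l', l' * ‖G (x + ⇑γ) m - G (x' + ⇑γ) m‖ₑ ^ q ≤ (2⁻¹ : ℝ≥0∞) ^ i) := by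
  have htr : ∀ γ : ℕ →₀ ℤ, Measurable fun x : ℕ → ℤ => x + ⇑γ := fun γ => by fun_prop
  obtain ⟨C1, hC1, U1, hU1, hCU1⟩ := exists_residual_open (Z := ℕ → ℤ)
    (J := (ℕ →₀ ℤ) × (ℕ →₀ ℤ) × ℕ × ℕ)
    (fun j => {x | tl q G j.2.2.1 (x + ⇑j.1) (x + ⇑j.2.1) ≤ (2⁻¹ : ℝ≥0∞) ^ j.2.2.2})
    (fun j => measurableSet_le (measurable_tl q G hG _ (htr _) (htr _)) measurable_const)
  obtain ⟨C2, hC2, U2, hU2, hCU2⟩ := exists_residual_open (Z := ℕ → ℤ)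
    (J := (ℕ →₀ ℤ) × ℕ × (TopologicalSpace.countableBasis Y))
    (fun j => {x | G (x + ⇑j.1) j.2.1 ∈ (j.2.2 : Set Y)})
    (fun j => ((measurable_pi_apply _).comp (hG.comp (htr _)))
      (TopologicalSpace.isOpen_of_mem_countableBasis j.2.2.2).measurableSet)
  obtain ⟨S, hSo, hSd, hSc, hSC⟩ := mem_residual_iff.1 (inter_mem hC1 hC2)
  obtain ⟨O, hO⟩ : ∃ O : ℕ → Set (ℕ → ℤ), insert Set.univ S = Set.range O :=
    (hSc.insert _).exists_eq_range (Set.insert_nonempty _ _)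
  have hOo : ∀ i, IsOpen (O i) := fun i => by
    have : O i ∈ insert Set.univ S := hO ▸ Set.mem_range_self i
    rcases this with h | h
    · rw [h]; exact isOpen_univ
    · exact hSo _ h
  have hOd : ∀ i, Dense (O i) := fun i => by
    have : O i ∈ insert Set.univ S := hO ▸ Set.mem_range_self i
    rcases this with h | h
    · rw [h]; exact dense_univ
    · exact hSd _ h
  have hOC : (⋂ j, O j) ⊆ C1 ∩ C2 := by
    refine subset_trans ?_ hSC
    rw [← Set.sInter_range, ← hO]
    exact Set.sInter_subset_sInter (Set.subset_insert _ _)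
  refine ⟨O, fun i b N Γ l => ?_⟩
  -- generic point
  have hres : {x : ℕ → ℤ | ∀ z : (ℕ →₀ ℤ) × ℕ, x + ⇑z.1 ∈ O z.2} ∈ residual (ℕ → ℤ) := by
    refine eventually_countable_forall.2 fun z => ?_
    have h1 : IsOpen {x : ℕ → ℤ | x + ⇑z.1 ∈ O z.2} :=
      (hOo z.2).preimage (Homeomorph.addRight (⇑z.1 : ℕ → ℤ)).continuous
    have h2 : Dense {x : ℕ → ℤ | x + ⇑z.1 ∈ O z.2} :=
      (hOd z.2).preimage (Homeomorph.addRight (⇑z.1 : ℕ → ℤ)).isOpenMap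
    exact residual_of_dense_open h1 h2
  have hcyl : IsOpen (PiNat.cylinder b N) := PiNat.isOpen_cylinder _ b N
  obtain ⟨x, hxb, hx⟩ := (dense_of_mem_residual hres).inter_open_nonempty _ hcyl
    ⟨b, PiNat.self_mem_cylinder b N⟩
  have hxC : ∀ γ : ℕ →₀ ℤ, x + ⇑γ ∈ C1 ∩ C2 := fun γ => hOC (Set.mem_iInter.2 fun i => hx (γ, i))
  have hx0 : x ∈ C1 ∩ C2 := by simpa using hxC 0
  -- choose l'
  have hl : ∀ᶠ l' in atTop, ∀ γ ∈ Γ, ∀ γ' ∈ Γ, tl q G l' (x + ⇑γ) (x + ⇑γ') ≤ (2⁻¹ : ℝ≥0∞) ^ i := by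
    rw [Filter.eventually_all_finset]; intro γ _
    rw [Filter.eventually_all_finset]; intro γ' _
    have h1 : Tendsto (fun l => tl q G l (x + ⇑γ) (x + ⇑γ')) atTop (𝓝 0) := by
      refine tendsto_tl hq G _ _ (hfin _ _ ?_)
      have h2 : ∀ δ : ℕ →₀ ℤ, ∀ᶠ n in atTop, δ n = 0 := fun δ => by
        have := δ.hasFiniteSupport
        have h3 := this.eventually_cofinite_notMem
        rw [Nat.cofinite_eq_atTop] at h3
        filter_upwards [h3] with n hn
        simpa using hn
      filter_upwards [h2 γ, h2 γ'] with n h3 h4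
      simp [h3, h4]
    exact (h1.eventually (gt_mem_nhds (ENNReal.pow_pos (by simp) i : (0:ℝ≥0∞) < (2⁻¹ : ℝ≥0∞) ^ i))).mono fun _ h => h.le
  obtain ⟨l', hl', hll'⟩ := (hl.and (eventually_gt_atTop l)).exists
  -- choose radius
  obtain ⟨δ, hδ0, hδ⟩ : ∃ δ : ℝ≥0∞, 0 < δ ∧ l' * δ ^ q ≤ (2⁻¹ : ℝ≥0∞) ^ i := by
    refine ⟨((2⁻¹ : ℝ≥0∞) ^ i / l') ^ (q⁻¹), ?_, ?_⟩
    · refine ENNReal.rpow_pos (ENNReal.div_pos (by simp) (by simp)) ?_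
      exact (ENNReal.div_lt_top (by simp) (by simp; omega)).ne
    · rw [← ENNReal.rpow_mul, inv_mul_cancel₀ (by linarith), ENNReal.rpow_one]
      exact ENNReal.mul_div_le
  have hV : ∀ (γ : ℕ →₀ ℤ) (m : ℕ), ∃ V : TopologicalSpace.countableBasis Y,
      G (x + ⇑γ) m ∈ (V : Set Y) ∧ ∀ y ∈ (V : Set Y), ∀ y' ∈ (V : Set Y), ‖y - y'‖ₑ ≤ δ := by
    intro γ m
    obtain ⟨V, hV, hm, hVs⟩ := (TopologicalSpace.isBasis_countableBasis Y).exists_subset_of_mem_open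
      (Metric.mem_eball_self (x := G (x + ⇑γ) m) (ENNReal.half_pos hδ0.ne')) Metric.isOpen_eball
    refine ⟨⟨V, hV⟩, hm, fun y hy y' hy' => ?_⟩
    rw [← edist_eq_enorm_sub]
    have h1 := Metric.mem_eball.1 (hVs hy)
    have h2 := Metric.mem_eball'.1 (hVs hy')
    calc edist y y' ≤ edist y (G (x + ⇑γ) m) + edist (G (x + ⇑γ) m) y' := edist_triangle _ _ _
      _ ≤ δ / 2 + δ / 2 := add_le_add h1.le h2.le
      _ = δ := ENNReal.add_halves δ
  choose V hVm hVd using hV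
  -- the open set
  let W : Set (ℕ → ℤ) := (⋂ γ ∈ Γ, {y | y + ⇑γ ∈ O i}) ∩
    (⋂ γ ∈ Γ, ⋂ γ' ∈ Γ, U1 (γ, γ', l', i)) ∩ (⋂ γ ∈ Γ, ⋂ m ∈ Finset.range l', U2 (γ, m, V γ m))
  have hWo : IsOpen W := by
    refine (IsOpen.inter ?_ ?_).inter ?_
    · exact isOpen_biInter_finset fun γ _ =>
        (hOo i).preimage (Homeomorph.addRight (⇑γ : ℕ → ℤ)).continuous
    · exact isOpen_biInter_finset fun γ _ => isOpen_biInter_finset fun γ' _ => hU1 _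
    · exact isOpen_biInter_finset fun γ _ => isOpen_biInter_finset fun m _ => hU2 _
  have hxW : x ∈ W := by
    refine ⟨⟨?_, ?_⟩, ?_⟩
    · simp only [Set.mem_iInter]; intro γ _; exact hx (γ, i)
    · simp only [Set.mem_iInter]; intro γ hγ γ' hγ'
      exact (hCU1 x hx0.1 (γ, γ', l', i)).1 (hl' γ hγ γ' hγ')
    · simp only [Set.mem_iInter]; intro γ hγ m hm
      exact (hCU2 x hx0.2 (γ, m, V γ m)).1 (hVm γ m)
  obtain ⟨N', hN', hNW⟩ : ∃ N', N < N' ∧ PiNat.cylinder x N' ⊆ W := by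
    obtain ⟨n, hn⟩ := (PiNat.isTopologicalBasis_cylinders _).exists_subset_of_mem_open hxW hWo
    obtain ⟨⟨y, n', rfl⟩, hxy, hs⟩ := hn
    have : PiNat.cylinder x n' = PiNat.cylinder y n' := PiNat.mem_cylinder_iff_eq.1 hxy
    exact ⟨max (N+1) n', by omega, (PiNat.cylinder_anti _ (le_max_right _ _)).trans (this ▸ hs)⟩
  refine ⟨x, N', l', hN', hll', ?_, ?_, ?_, ?_⟩
  · intro k hk; exact PiNat.mem_cylinder_iff.1 hxb k hk
  · intro y hy γ hγ
    have := (hNW hy).1.1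
    simp only [Set.mem_iInter] at this
    exact this γ hγ
  · intro y hy hyO γ hγ γ' hγ'
    have := (hNW hy).1.2
    simp only [Set.mem_iInter] at this
    exact (hCU1 y (hOC hyO).1 (γ, γ', l', i)).2 (this γ hγ γ' hγ')
  · intro y hy hyO y' hy' hyO' γ hγ m hm
    have h1 := (hNW hy).2
    have h2 := (hNW hy').2
    simp only [Set.mem_iInter] at h1 h2
    have h3 := (hCU2 y (hOC hyO).2 (γ, m, V γ m)).2 (h1 γ hγ m (Finset.mem_range.2 hm))
    have h4 := (hCU2 y' (hOC hyO').2 (γ, m, V γ m)).2 (h2 γ hγ m (Finset.mem_range.2 hm))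
    refine le_trans ?_ hδ
    gcongr
    exact hVd γ m _ h3 _ h4
end

section
variable {Y : Type*} [NormedAddCommGroup Y] [MeasurableSpace Y] [BorelSpace Y]
  [SecondCountableTopology Y]

lemma fusion_seq {q : ℝ} (hq : 1 ≤ q) (G : (ℕ → ℤ) → ℕ → Y) (hG : Measurable G)
    (hfin : ∀ x y : ℕ → ℤ, (∀ᶠ n in atTop, x n = y n) → Summable fun m => ‖G x m - G y m‖ ^ q) :
    ∃ (n l : ℕ → ℕ) (xs : ℕ → ℤ), StrictMono n ∧ StrictMono l ∧
      (∀ α β : ℕ → ℤ, (∀ j, |α j| ≤ j) → (∀ j, |β j| ≤ j) → ∀ i, (∀ j, i < j → α j = β j) →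
        tl q G (l i) (Function.extend n α xs) (Function.extend n β xs) ≤ (2⁻¹ : ℝ≥0∞) ^ i) ∧
      (∀ α β : ℕ → ℤ, (∀ j, |α j| ≤ j) → (∀ j, |β j| ≤ j) → ∀ i, (∀ j, j ≤ i → α j = β j) →
        ∀ m < l i, l i * ‖G (Function.extend n α xs) m - G (Function.extend n β xs) m‖ₑ ^ q
          ≤ (2⁻¹ : ℝ≥0∞) ^ i) := by
  obtain ⟨O, hO⟩ := fusion_generic hq G hG hfin
  choose fb fN fl h1 h2 h3 h4 h5 h6 using hO
  let step : ℕ → ((ℕ → ℤ) × ℕ × Finset (ℕ →₀ ℤ) × ℕ) → ((ℕ → ℤ) × ℕ × Finset (ℕ →₀ ℤ) × ℕ) :=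
    fun i S =>
    (fb i (Function.update S.1 S.2.1 0) (S.2.1 + 1) (gam S.2.2.1 S.2.1 i) S.2.2.2,
     fN i (Function.update S.1 S.2.1 0) (S.2.1 + 1) (gam S.2.2.1 S.2.1 i) S.2.2.2,
     gam S.2.2.1 S.2.1 i,
     fl i (Function.update S.1 S.2.1 0) (S.2.1 + 1) (gam S.2.2.1 S.2.1 i) S.2.2.2)
  let st : ℕ → ((ℕ → ℤ) × ℕ × Finset (ℕ →₀ ℤ) × ℕ) := fun i =>
    Nat.rec (0, 0, {0}, 0) step i
  let b : ℕ → ℕ → ℤ := fun i => (st i).1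
  let n : ℕ → ℕ := fun i => (st i).2.1
  let Γ : ℕ → Finset (ℕ →₀ ℤ) := fun i => (st i).2.2.1
  let l : ℕ → ℕ := fun i => (st i).2.2.2
  have hΓ0 : Γ 0 = {0} := rfl
  have hΓ : ∀ i, Γ (i+1) = gam (Γ i) (n i) i := fun i => rfl
  have hn1 : ∀ i, n i + 1 < n (i+1) := fun i => h1 _ _ _ _ _
  have hl1 : ∀ i, l i < l (i+1) := fun i => h2 _ _ _ _ _
  have hb1 : ∀ i, ∀ k < n i + 1, b (i+1) k = Function.update (b i) (n i) 0 k :=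
    fun i => h3 _ _ _ _ _
  have g4 : ∀ i, ∀ x ∈ PiNat.cylinder (b (i+1)) (n (i+1)), ∀ γ ∈ Γ (i+1), x + ⇑γ ∈ O i :=
    fun i => h4 i (Function.update (b i) (n i) 0) (n i + 1) (gam (Γ i) (n i) i) (l i)
  have g5 : ∀ i, ∀ x ∈ PiNat.cylinder (b (i+1)) (n (i+1)), x ∈ (⋂ j, O j) → ∀ γ ∈ Γ (i+1),
      ∀ γ' ∈ Γ (i+1), tl q G (l (i+1)) (x + ⇑γ) (x + ⇑γ') ≤ (2⁻¹ : ℝ≥0∞) ^ i := fun i => h5 i (Function.update (b i) (n i) 0) (n i + 1) (gam (Γ i) (n i) i) (l i)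
  have g6 : ∀ i, ∀ x ∈ PiNat.cylinder (b (i+1)) (n (i+1)), x ∈ (⋂ j, O j) →
      ∀ x' ∈ PiNat.cylinder (b (i+1)) (n (i+1)), x' ∈ (⋂ j, O j) → ∀ γ ∈ Γ (i+1),
      ∀ m < l (i+1), l (i+1) * ‖G (x + ⇑γ) m - G (x' + ⇑γ) m‖ₑ ^ q ≤ (2⁻¹ : ℝ≥0∞) ^ i :=
    fun i => h6 i (Function.update (b i) (n i) 0) (n i + 1) (gam (Γ i) (n i) i) (l i)
  have hnm : StrictMono n := strictMono_nat_of_lt_succ fun i => by have := hn1 i; omega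
  have hlm : StrictMono l := strictMono_nat_of_lt_succ hl1
  clear_value b n Γ l
  clear h1 h2 h3 h4 h5 h6
  have hb2 : ∀ i, ∀ k < n i, b (i+1) k = b i k := fun i k hk => by
    rw [hb1 i k (by omega), Function.update_of_ne (by omega)]
  have hb0 : ∀ i, b (i+1) (n i) = 0 := fun i => by
    rw [hb1 i _ (by omega), Function.update_self]
  have hb3 : ∀ i j, i ≤ j → ∀ k < n i, b j k = b i k := by
    intro i j hij k hk
    induction j, hij using Nat.le_induction with
    | base => rfl
    | succ j hij ih => rw [hb2 j k (hk.trans_le (hnm.monotone hij)), ih]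
  have hxs : ∀ i, ∀ k < n i, b (k+1) k = b i k := by
    intro i k hk
    have hk1 : k < n (k+1) := lt_of_lt_of_le (Nat.lt_succ_self k) hnm.le_apply
    rw [← hb3 i (max i (k+1)) (le_max_left _ _) k hk, ← hb3 (k+1) _ (le_max_right i _) k hk1]
  set xs : ℕ → ℤ := fun k => b (k+1) k with hxsd
  have hxs0 : ∀ i, xs (n i) = 0 := fun i => by
    rw [← hb0 i]; exact hxs (i+1) _ (hnm (Nat.lt_succ_self i))
  let P : (ℕ → ℤ) → (ℕ → ℤ) := fun α => Function.extend n α xs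
  have hPn : ∀ α j, P α (n j) = α j := fun α j => hnm.injective.extend_apply α xs j
  have hPo : ∀ α k, (¬ ∃ j, n j = k) → P α k = xs k := fun α k hk => Function.extend_apply' _ _ _ hk
  let z : ℕ → (ℕ → ℤ) → (ℕ → ℤ) := fun i α j => if j ≤ i then 0 else α j
  let γ : ℕ → (ℕ → ℤ) → (ℕ →₀ ℤ) := fun i α => ∑ j ∈ Finset.range (i+1), Finsupp.single (n j) (α j)
  have hdec : ∀ i α, P α = P (z i α) + ⇑(γ i α) := by
    intro i α
    funext k
    by_cases hk : ∃ j, n j = k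
    · obtain ⟨j, rfl⟩ := hk
      simp only [Pi.add_apply, hPn, γ, z, Finsupp.finsetSum_apply, Finsupp.single_apply,
        hnm.injective.eq_iff, Finset.sum_ite_eq', Finset.mem_range]
      split_ifs <;> first | omega | simp
    · simp only [Pi.add_apply, hPo _ k hk, γ, Finsupp.finsetSum_apply, Finsupp.single_apply]
      rw [Finset.sum_eq_zero, add_zero]
      intro j _
      rw [if_neg]; exact fun h => hk ⟨j, h⟩
  have hcyl : ∀ i α, P (z i α) ∈ PiNat.cylinder (b (i+1)) (n (i+1)) := by
    intro i α
    rw [PiNat.mem_cylinder_iff]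
    intro k hk
    by_cases hk' : ∃ j, n j = k
    · obtain ⟨j, rfl⟩ := hk'
      have hj : j ≤ i := by have := hnm.lt_iff_lt.1 hk; omega
      rw [hPn, ← hxs _ _ hk]
      change _ = xs (n j)
      rw [hxs0]; simp [z, hj]
    · rw [hPo _ _ hk', ← hxs _ _ hk]
  have hγ : ∀ α : ℕ → ℤ, (∀ j, |α j| ≤ j) → ∀ i, γ i α ∈ Γ (i+1) := by
    intro α hα i
    induction i with
    | zero =>
      rw [hΓ]; simp only [gam, hΓ0, Finset.mem_image, Finset.mem_product]
      exact ⟨(0, α 0), ⟨by simp, by have := hα 0; rw [abs_le] at this; exact Finset.mem_Icc.2 this⟩, by simp [γ]⟩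
    | succ i ih =>
      rw [hΓ]; simp only [gam, Finset.mem_image, Finset.mem_product]
      refine ⟨(γ i α, α (i+1)), ⟨ih, by simpa [abs_le] using hα (i+1)⟩, ?_⟩
      simp only [γ]
      rw [Finset.sum_range_succ _ (i+1)]
  have hzb : ∀ (α : ℕ → ℤ), (∀ j, |α j| ≤ j) → ∀ i j, |z i α j| ≤ j := by
    intro α hα i j
    simp only [z]; split_ifs
    · simp
    · exact hα j
  have hPO : ∀ (α : ℕ → ℤ), (∀ j, |α j| ≤ j) → P α ∈ ⋂ j, O j := by
    intro α hα
    refine Set.mem_iInter.2 fun i => ?_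
    rw [hdec i α]
    exact g4 i _ (hcyl i α) _ (hγ α hα i)
  refine ⟨n, fun i => l (i+1), xs, hnm, fun i j hij => hlm (by omega), ?_, ?_⟩
  · intro α β hα hβ i hij
    have hz : z i α = z i β := by
      funext j; simp only [z]; split_ifs with h
      · rfl
      · exact hij j (by omega)
    change tl q G (l (i+1)) (P α) (P β) ≤ _
    rw [hdec i α, hdec i β, ← hz]
    exact g5 i _ (hcyl i α) (hPO _ (hzb α hα i)) _ (hγ α hα i) _ (hγ β hβ i)
  · intro α β hα hβ i hij m hm
    have hz : γ i α = γ i β := by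
      refine Finset.sum_congr rfl fun j hj => ?_
      rw [hij j (by simp at hj; omega)]
    change l (i+1) * ‖G (P α) m - G (P β) m‖ₑ ^ q ≤ _
    rw [hdec i α, hdec i β, ← hz]
    exact g6 i _ (hcyl i α) (hPO _ (hzb α hα i)) _ (hcyl i β) (hPO _ (hzb β hβ i)) _ (hγ α hα i)
      m hm
end

lemma summable_iff_enorm {Y : Type*} [NormedAddCommGroup Y] {q : ℝ} (hq : 1 ≤ q) (f : ℕ → Y) :
    (Summable fun m => ‖f m‖ ^ q) ↔ ∑' m, ‖f m‖ₑ ^ q ≠ ⊤ := by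
  have h : (fun m => ‖f m‖ₑ ^ q) = fun m => ENNReal.ofReal (‖f m‖ ^ q) := by
    funext m
    rw [← ENNReal.ofReal_rpow_of_nonneg (norm_nonneg _) (by linarith), ofReal_norm]
  rw [h]
  constructor
  · intro h; exact h.tsum_ofReal_ne_top
  · intro h
    have := ENNReal.summable_toReal h
    refine this.congr fun m => ENNReal.toReal_ofReal (by positivity)

lemma ESum.symm' {Y : Type*} [NormedAddCommGroup Y] {q : ℝ} {x y : ℕ → Y} (h : ESum Y q x y) :
    ESum Y q y x := by
  unfold ESum at *
  simpa only [norm_sub_rev] using h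

lemma ESum.trans' {Y : Type*} [NormedAddCommGroup Y] {q : ℝ} (hq : 1 ≤ q) {x y z : ℕ → Y}
    (h : ESum Y q x y) (h' : ESum Y q y z) : ESum Y q x z := by
  unfold ESum at *
  refine Summable.of_nonneg_of_le (fun m => by positivity) (fun m => ?_)
    ((h.add h').mul_left ((2:ℝ) ^ (q-1)))
  have h1 : x m - z m = (x m - y m) + (y m - z m) := by abel
  rw [h1]
  exact norm_add_rpow_le hq _ _

lemma tsum_half_ne_top : ∑' i : ℕ, (2⁻¹ : ℝ≥0∞) ^ i ≠ ⊤ := by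
  rw [ENNReal.tsum_geometric]
  simp

section
variable {Y : Type*} [NormedAddCommGroup Y] [MeasurableSpace Y] [BorelSpace Y]
  [SecondCountableTopology Y]

lemma block_G {q : ℝ} (hq : 1 ≤ q) (G : (ℕ → ℤ) → ℕ → Y) (hG : Measurable G)
    (hfin : ∀ x y : ℕ → ℤ, (∀ᶠ n in atTop, x n = y n) → Summable fun m => ‖G x m - G y m‖ ^ q) :
    ∃ (n : ℕ → ℕ) (xs : ℕ → ℤ) (blk l : ℕ → ℕ) (T : ℕ → ℤ → Y), StrictMono n ∧
      (∀ m, m < l (blk m)) ∧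
      (∀ α : ℕ → ℤ, (∀ j, |α j| ≤ j) →
        ESum Y q (G (Function.extend n α xs)) (fun m => T m (α (blk m)))) := by
  classical
  obtain ⟨n, l, xs, hn, hl, ha, hb⟩ := fusion_seq hq G hG hfin
  have hex : ∀ m, ∃ i, m < l i := fun m => ⟨m+1, lt_of_lt_of_le (Nat.lt_succ_self m) hl.le_apply⟩
  let blk : ℕ → ℕ := fun m => Nat.find (hex m)
  have hblk1 : ∀ m, m < l (blk m) := fun m => Nat.find_spec (hex m)
  have hblk2 : ∀ m i, blk m = i + 1 → l i ≤ m := fun m i h => by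
    have := Nat.find_min (hex m) (m := i) (by change i < blk m; omega)
    omega
  clear_value blk
  refine ⟨n, xs, blk, l, fun m a => G (Function.extend n (Pi.single (blk m) a) xs) m, hn, hblk1,
    fun α hα => ?_⟩
  let u : ℕ → ℕ → ℤ := fun i j => if j < i then 0 else α j
  have hu : ∀ i j, |u i j| ≤ j := fun i j => by
    simp only [u]; split_ifs
    · simp
    · exact hα j
  have hsb : ∀ i j, |(Pi.single i (α i) : ℕ → ℤ) j| ≤ j := fun i j => by
    rw [Pi.single_apply]; split_ifs with h
    · rw [h]; exact hα i
    · simp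
  refine ESum.trans' hq (y := fun m => G (Function.extend n (u (blk m)) xs) m) ?_ ?_
  · unfold ESum
    rw [summable_iff_enorm hq]
    rw [← ENNReal.tsum_fiberwise _ blk]
    refine ne_top_of_le_ne_top (b := 2 * ∑' i : ℕ, (2⁻¹ : ℝ≥0∞) ^ i)
      (ENNReal.mul_ne_top (by simp) tsum_half_ne_top) ?_
    rw [← ENNReal.tsum_mul_left]
    refine ENNReal.tsum_le_tsum fun i => ?_
    rcases i with _ | i
    · have : ∀ m : blk ⁻¹' {0}, ‖G (Function.extend n α xs) m -
          G (Function.extend n (u (blk m)) xs) m‖ₑ ^ q = 0 := by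
        rintro ⟨m, hm⟩
        have hm : blk m = 0 := hm
        have : u 0 = α := by funext j; simp [u]
        simp [hm, this]; linarith
      rw [ENNReal.tsum_eq_zero.2 this]; simp
    · calc ∑' m : blk ⁻¹' {i+1}, ‖G (Function.extend n α xs) m -
          G (Function.extend n (u (blk m)) xs) m‖ₑ ^ q
          = ∑' m : blk ⁻¹' {i+1}, (fun m' => ‖G (Function.extend n α xs) (m' + l i) -
            G (Function.extend n (u (i+1)) xs) (m' + l i)‖ₑ ^ q) ((m:ℕ) - l i) := by
            refine tsum_congr fun m => ?_
            have hm : blk m = i+1 := m.2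
            have := hblk2 _ _ hm
            rw [hm]; beta_reduce; rw [Nat.sub_add_cancel this]
        _ ≤ tl q G (l i) (Function.extend n α xs) (Function.extend n (u (i+1)) xs) := by
            unfold tl
            refine ENNReal.tsum_comp_le_tsum_of_injective
              (f := fun m : blk ⁻¹' {i+1} => (m:ℕ) - l i) ?_ _
            intro m m' h
            have := hblk2 _ _ m.2
            have := hblk2 _ _ m'.2
            have h : (m:ℕ) - l i = m' - l i := h
            exact Subtype.ext (by omega)
        _ ≤ (2⁻¹) ^ i := ha _ _ hα (hu _) i (fun j hj => by simp [u]; omega)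
        _ = 2 * 2⁻¹ ^ (i+1) := by
            rw [pow_succ', ← mul_assoc, ENNReal.mul_inv_cancel (by simp) (by simp), one_mul]
  · unfold ESum
    rw [summable_iff_enorm hq]
    rw [← ENNReal.tsum_fiberwise _ blk]
    refine ne_top_of_le_ne_top tsum_half_ne_top ?_
    refine ENNReal.tsum_le_tsum fun i => ?_
    calc ∑' m : blk ⁻¹' {i}, ‖G (Function.extend n (u (blk m)) xs) m -
          G (Function.extend n (Pi.single (blk m) (α (blk m))) xs) m‖ₑ ^ q
        = ∑' m : blk ⁻¹' {i}, ‖G (Function.extend n (u i) xs) m -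
          G (Function.extend n (Pi.single i (α i)) xs) m‖ₑ ^ q := by
          refine tsum_congr fun m => ?_
          have hm : blk m = i := m.2
          rw [hm]
      _ ≤ ∑' m : Finset.range (l i), ‖G (Function.extend n (u i) xs) m -
          G (Function.extend n (Pi.single i (α i)) xs) m‖ₑ ^ q := by
          refine ENNReal.tsum_mono_subtype (fun m => ‖G (Function.extend n (u i) xs) m -
            G (Function.extend n (Pi.single i (α i)) xs) m‖ₑ ^ q)
            (s := blk ⁻¹' {i}) (t := (Finset.range (l i) : Set ℕ)) ?_
          intro m hm
          have hm : blk m = i := hm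
          have := hblk1 m
          rw [hm] at this
          simpa using this
      _ = ∑ m ∈ Finset.range (l i), ‖G (Function.extend n (u i) xs) m -
          G (Function.extend n (Pi.single i (α i)) xs) m‖ₑ ^ q := 
            Finset.tsum_subtype (Finset.range (l i)) (fun m => ‖G (Function.extend n (u i) xs) m -
            G (Function.extend n (Pi.single i (α i)) xs) m‖ₑ ^ q)
      _ ≤ ∑ m ∈ Finset.range (l i), (2⁻¹ : ℝ≥0∞)^i / (l i : ℝ≥0∞) := by
          refine Finset.sum_le_sum fun m hm => ?_
          have hm : m < l i := by simpa using hm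
          rw [ENNReal.le_div_iff_mul_le (by simp) (by simp), mul_comm]
          refine hb _ _ (hu i) (hsb i) i (fun j hj => ?_) m hm
          simp only [u, Pi.single_apply]
          split_ifs <;> first | omega | (subst_vars; rfl)
      _ ≤ _ := by
          rw [Finset.sum_const, Finset.card_range, nsmul_eq_mul]
          exact ENNReal.mul_div_le

lemma block_form {X : Type*} [NormedAddCommGroup X] [MeasurableSpace X] {p q : ℝ} (hp : 1 ≤ p)
    (hq : 1 ≤ q) (h : BorelReducible (ESum X p) (ESum Y q)) (d : ℤ → X) :
    ∃ (F : ℕ → Finset ℕ) (T : ℕ → ℤ → Y), ∀ α β : ℕ → ℤ, (∀ j, |α j| ≤ j) → (∀ j, |β j| ≤ j) →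
      ((Summable fun i => ‖d (α i) - d (β i)‖ ^ p) ↔
        Summable fun i => ∑ m ∈ F i, ‖T m (α i) - T m (β i)‖ ^ q) := by
  classical
  obtain ⟨θ, hθ, hθ2⟩ := h
  have hmeas : Measurable fun x : ℕ → ℤ => θ (fun n => d (x n)) := by
    refine hθ.comp (measurable_pi_lambda _ fun n => ?_)
    exact (measurable_of_countable d).comp (measurable_pi_apply n)
  have h0p : (0:ℝ) ^ p = 0 := Real.zero_rpow (by linarith)
  obtain ⟨n, xs, blk, l, T, hn, hblk, hT⟩ := block_G hq (fun x : ℕ → ℤ => θ (fun n => d (x n)))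
    hmeas (fun x y hxy => by
      refine (hθ2 _ _).1 ?_
      unfold ESum
      refine summable_of_hasFiniteSupport ?_
      rw [← Nat.cofinite_eq_atTop] at hxy
      refine Set.Finite.subset hxy fun k hk hk' => hk ?_
      have hk' : x k = y k := hk'
      simp only [hk', sub_self, norm_zero, h0p])
  refine ⟨fun i => (Finset.range (l i)).filter fun m => blk m = i, T, fun α β hα hβ => ?_⟩
  have e1 : (Summable fun i => ‖d (α i) - d (β i)‖ ^ p) ↔
      ESum X p (fun k => d (Function.extend n α xs k)) (fun k => d (Function.extend n β xs k)) := by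
    unfold ESum
    rw [← hn.injective.summable_iff (f := fun k => ‖d (Function.extend n α xs k) -
      d (Function.extend n β xs k)‖ ^ p)]
    · refine summable_congr fun i => ?_
      simp only [Function.comp]
      rw [hn.injective.extend_apply, hn.injective.extend_apply]
    · intro k hk
      rw [Function.extend_apply' _ _ _ hk, Function.extend_apply' _ _ _ hk]
      simp [h0p]
  have e2 : ESum Y q (fun m => T m (α (blk m))) (fun m => T m (β (blk m))) ↔
      Summable fun i => ∑ m ∈ (Finset.range (l i)).filter (fun m => blk m = i),
        ‖T m (α i) - T m (β i)‖ ^ q := by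
    unfold ESum
    rw [← (Equiv.sigmaFiberEquiv blk).summable_iff, summable_sigma_of_nonneg
      (fun _ => by simp only [Function.comp]; positivity)]
    have hfib : ∀ i m, blk m = i → m ∈ (Finset.range (l i)).filter fun m => blk m = i := by
      intro i m h
      have := hblk m
      rw [h] at this
      simp [this, h]
    have hf : ∀ i, Finite {m // blk m = i} := fun i =>
      Finite.of_injective (β := (Finset.range (l i)).filter fun m => blk m = i)
        (fun m => ⟨m.1, hfib i m.1 m.2⟩) (fun a b h => Subtype.ext (by simpa using h))
    rw [and_iff_right (fun i => by have := hf i; exact Summable.of_finite)]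
    refine summable_congr fun i => ?_
    simp only [Function.comp, Equiv.sigmaFiberEquiv, Equiv.coe_fn_mk]
    have : ∀ m : {m // blk m = i}, ‖T m (α (blk m)) - T m (β (blk m))‖ ^ q =
      (fun m => ‖T m (α i) - T m (β i)‖ ^ q) (m:ℕ) := fun m => by simp only [m.2]
    rw [tsum_congr this]
    have hset : (↑((Finset.range (l i)).filter fun m => blk m = i) : Set ℕ) = {m | blk m = i} := by
      ext m; exact ⟨fun h => by simp at h; exact h.2, fun h => hfib i m h⟩
    rw [← Finset.tsum_subtype' , hset]
    rfl
  rw [e1, hθ2, ← e2]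
  constructor
  · intro h; exact (hT α hα).symm'.trans' hq (h.trans' hq (hT β hβ))
  · intro h; exact (hT α hα).trans' hq (h.trans' hq (hT β hβ).symm')
end

lemma flatten_lemma (e : ℤ → ℤ → ℝ) (τ : ℕ → ℤ → ℤ → ℝ) (he0 : ∀ a, e a a = 0)
    (hτ0 : ∀ i a, τ i a a = 0)
    (H : ∀ α β : ℕ → ℤ, (∀ j, |α j| ≤ j) → (∀ j, |β j| ≤ j) →
      ((Summable fun i => e (α i) (β i)) ↔ Summable fun i => τ i (α i) (β i)))
    (a b : ℕ → ℤ) (N : ℕ → ℕ) (hN : ∀ k, 0 < N k) (Q : ℕ → ℕ → Prop)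
    (hQ : ∀ k, ∃ᶠ i in atTop, Q k i) :
    ∃ κ φ : ℕ → ℕ, (∀ j, Q (κ j) (φ j)) ∧
      (∀ f : ℕ → ℝ, (∀ k, 0 ≤ f k) → ((Summable fun j => f (κ j)) ↔ Summable fun k => N k * f k)) ∧
      ((Summable fun j => e (a (κ j)) (b (κ j))) ↔
        Summable fun j => τ (φ j) (a (κ j)) (b (κ j))) := by
  have : Infinite (Σ k : ℕ, Fin (N k)) :=
    Infinite.of_injective (fun k => (⟨k, ⟨0, hN k⟩⟩ : Σ k : ℕ, Fin (N k)))
      (fun k k' h => (Sigma.mk.inj h).1)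
  have : Denumerable (Σ k : ℕ, Fin (N k)) := (nonempty_denumerable _).some
  let ε := (Denumerable.eqv (Σ k : ℕ, Fin (N k))).symm
  obtain ⟨φ, hφ, hφQ⟩ := extraction_forall_of_frequently
    (P := fun j i => Q (ε j).1 i ∧ |a (ε j).1| ≤ i ∧ |b (ε j).1| ≤ i) (fun j => by
      refine (hQ _).and_eventually ?_
      filter_upwards [eventually_ge_atTop (|a (ε j).1|.toNat + |b (ε j).1|.toNat)] with i hi
      have h1 := Int.self_le_toNat |a (ε j).1|
      have h2 := Int.self_le_toNat |b (ε j).1|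
      omega)
  refine ⟨fun j => (ε j).1, φ, fun j => (hφQ j).1, ?_, ?_⟩
  · intro f hf
    rw [show (fun j => f (ε j).1) = (fun z : Σ k : ℕ, Fin (N k) => f z.1) ∘ ε from rfl,
      ε.summable_iff, summable_sigma_of_nonneg (fun z => hf _),
      and_iff_right (fun _ => Summable.of_finite)]
    refine summable_congr fun k => ?_
    simp
  · have hbd : ∀ c : ℕ → ℤ, (∀ j, |c j| ≤ φ j) → ∀ i, |Function.extend φ c 0 i| ≤ i := by
      intro c hc i
      by_cases hi : ∃ j, φ j = i
      · obtain ⟨j, rfl⟩ := hi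
        rw [hφ.injective.extend_apply]; exact hc j
      · rw [Function.extend_apply' _ _ _ hi]; simp
    have := H _ _ (hbd (fun j => a (ε j).1) fun j => (hφQ j).2.1)
      (hbd (fun j => b (ε j).1) fun j => (hφQ j).2.2)
    have k1 := hφ.injective.summable_iff (f := fun i => e (Function.extend φ (fun j => a (ε j).1) 0 i)
      (Function.extend φ (fun j => b (ε j).1) 0 i)) (fun i hi => by
        rw [Function.extend_apply' _ _ _ hi, Function.extend_apply' _ _ _ hi]; simp [he0])
    have k2 := hφ.injective.summable_iff (f := fun i => τ i (Function.extend φ (fun j => a (ε j).1) 0 i)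
      (Function.extend φ (fun j => b (ε j).1) 0 i)) (fun i hi => by
        rw [Function.extend_apply' _ _ _ hi, Function.extend_apply' _ _ _ hi]; simp [hτ0])
    rw [← k1, ← k2] at this
    simp only [Function.comp_def, hφ.injective.extend_apply] at this
    exact this

lemma not_summable_of_one_le {f : ℕ → ℝ} (h : ∀ k, 1 ≤ f k) : ¬ Summable f := fun hf => by
  have := hf.tendsto_atTop_zero
  have := ge_of_tendsto' this h
  linarith

lemma uniform_bounds (e : ℤ → ℤ → ℝ) (τ : ℕ → ℤ → ℤ → ℝ) (he0 : ∀ a, e a a = 0)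
    (hτ0 : ∀ i a, τ i a a = 0) (hτn : ∀ i a b, 0 ≤ τ i a b)
    (H : ∀ α β : ℕ → ℤ, (∀ j, |α j| ≤ j) → (∀ j, |β j| ≤ j) →
      ((Summable fun i => e (α i) (β i)) ↔ Summable fun i => τ i (α i) (β i))) :
    ∃ C > 0, ∃ δ > 0, ∀ a b, 0 < e a b → e a b ≤ δ →
      ∀ᶠ i in atTop, τ i a b ≤ C * e a b ∧ e a b ≤ C * τ i a b := by
  have up : ∃ k : ℕ, ∀ a b, 0 < e a b → e a b ≤ 2⁻¹ ^ k →
      ∀ᶠ i in atTop, τ i a b ≤ 2 ^ k * e a b := by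
    by_contra! hc
    choose a b h1 h2 h3 using hc
    have h3' : ∀ k, ∃ᶠ i in atTop, 2 ^ k * e (a k) (b k) < τ i (a k) (b k) := fun k => by
      simpa using h3 k
    have hN1 : ∀ k, 0 < ⌈(2⁻¹:ℝ) ^ k / e (a k) (b k)⌉₊ := fun k =>
      Nat.ceil_pos.2 (div_pos (by positivity) (h1 k))
    obtain ⟨κ, φ, hQ, hf, hs⟩ := flatten_lemma e τ he0 hτ0 H a b
      (fun k => ⌈(2⁻¹:ℝ) ^ k / e (a k) (b k)⌉₊) hN1 _ h3'
    have s1 : Summable fun j => e (a (κ j)) (b (κ j)) := by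
      rw [hf (fun k => e (a k) (b k)) (fun k => (h1 k).le)]
      refine Summable.of_nonneg_of_le (fun k => mul_nonneg (by positivity) (h1 k).le) (fun k => ?_)
        ((summable_geometric_of_lt_one (r := (2⁻¹:ℝ)) (by norm_num) (by norm_num)).mul_left 2)
      have := (Nat.ceil_lt_add_one (a := (2⁻¹:ℝ) ^ k / e (a k) (b k))
        (div_pos (by positivity) (h1 k)).le).le
      calc (⌈(2⁻¹:ℝ) ^ k / e (a k) (b k)⌉₊ : ℝ) * e (a k) (b k)
          ≤ ((2⁻¹:ℝ) ^ k / e (a k) (b k) + 1) * e (a k) (b k) :=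
            mul_le_mul_of_nonneg_right this (h1 k).le
        _ = (2⁻¹:ℝ) ^ k + e (a k) (b k) := by have := (h1 k).ne'; field_simp
        _ ≤ _ := by linarith [h2 k]
    have s2 : Summable fun j => 2 ^ (κ j) * e (a (κ j)) (b (κ j)) :=
      Summable.of_nonneg_of_le (fun j => mul_nonneg (by positivity) (h1 _).le)
        (fun j => (hQ j).le) (hs.1 s1)
    rw [hf (fun k => 2 ^ k * e (a k) (b k)) (fun k => mul_nonneg (by positivity) (h1 k).le)] at s2
    refine not_summable_of_one_le (fun k => ?_) s2
    have h4 := Nat.le_ceil ((2⁻¹:ℝ) ^ k / e (a k) (b k))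
    have h5 : (0:ℝ) < 2 ^ k * e (a k) (b k) := mul_pos (by positivity) (h1 k)
    calc (1:ℝ) = (2⁻¹:ℝ) ^ k / e (a k) (b k) * (2 ^ k * e (a k) (b k)) := by
          have := (h1 k).ne'
          rw [inv_pow]; field_simp
      _ ≤ _ := mul_le_mul_of_nonneg_right h4 h5.le
  have lo : ∃ k : ℕ, ∀ a b, 0 < e a b → e a b ≤ 1 →
      ∀ᶠ i in atTop, e a b ≤ 2 ^ k * τ i a b := by
    by_contra! hc
    choose a b h1 h2 h3 using hc
    have h3' : ∀ k, ∃ᶠ i in atTop, 2 ^ k * τ i (a k) (b k) < e (a k) (b k) := fun k => by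
      simpa using h3 k
    have hN1 : ∀ k, 0 < ⌈1 / e (a k) (b k)⌉₊ := fun k =>
      Nat.ceil_pos.2 (div_pos one_pos (h1 k))
    obtain ⟨κ, φ, hQ, hf, hs⟩ := flatten_lemma e τ he0 hτ0 H a b
      (fun k => ⌈1 / e (a k) (b k)⌉₊) hN1 _ h3'
    have s1 : Summable fun j => (2⁻¹:ℝ) ^ (κ j) * e (a (κ j)) (b (κ j)) := by
      rw [hf (fun k => (2⁻¹:ℝ) ^ k * e (a k) (b k)) (fun k => mul_nonneg (by positivity) (h1 k).le)]
      refine Summable.of_nonneg_of_le (fun k => mul_nonneg (by positivity)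
        (mul_nonneg (by positivity) (h1 k).le)) (fun k => ?_)
        ((summable_geometric_of_lt_one (r := (2⁻¹:ℝ)) (by norm_num) (by norm_num)).mul_left 2)
      have := (Nat.ceil_lt_add_one (a := 1 / e (a k) (b k))
        (div_pos one_pos (h1 k)).le).le
      calc (⌈1 / e (a k) (b k)⌉₊ : ℝ) * (2⁻¹ ^ k * e (a k) (b k))
          ≤ (1 / e (a k) (b k) + 1) * (2⁻¹ ^ k * e (a k) (b k)) :=
            mul_le_mul_of_nonneg_right this (mul_nonneg (by positivity) (h1 k).le)
        _ = (1 + e (a k) (b k)) * 2⁻¹ ^ k := by have := (h1 k).ne'; field_simp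
        _ ≤ _ := mul_le_mul_of_nonneg_right (by linarith [h2 k]) (by positivity)
    have s2 : Summable fun j => τ (φ j) (a (κ j)) (b (κ j)) := by
      refine Summable.of_nonneg_of_le (fun j => hτn _ _ _) (fun j => ?_) s1
      rw [inv_pow, ← div_eq_inv_mul, le_div_iff₀ (by positivity), mul_comm]
      exact (hQ j).le
    have s3 := hs.2 s2
    rw [hf (fun k => e (a k) (b k)) (fun k => (h1 k).le)] at s3
    refine not_summable_of_one_le (fun k => ?_) s3
    have h4 := Nat.le_ceil (1 / e (a k) (b k))
    calc (1:ℝ) = 1 / e (a k) (b k) * (e (a k) (b k)) := by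
          have := (h1 k).ne'
          field_simp
      _ ≤ _ := mul_le_mul_of_nonneg_right h4 (h1 k).le
  obtain ⟨k, hk⟩ := up
  obtain ⟨k', hk'⟩ := lo
  refine ⟨2 ^ (k + k'), by positivity, 2⁻¹ ^ k, by positivity, fun a b h1 h2 => ?_⟩
  have h3 : (2⁻¹:ℝ) ^ k ≤ 1 := pow_le_one₀ (by norm_num) (by norm_num)
  filter_upwards [hk a b h1 h2, hk' a b h1 (h2.trans h3)] with i h4 h5
  constructor
  · refine h4.trans (mul_le_mul_of_nonneg_right ?_ h1.le)
    exact pow_le_pow_right₀ (by norm_num) (by omega)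
  · refine h5.trans (mul_le_mul_of_nonneg_right ?_ (hτn _ _ _))
    exact pow_le_pow_right₀ (by norm_num) (by omega)

lemma finite_embed {X Y κ : Type*} [NormedAddCommGroup X] [MeasurableSpace X]
    [NormedAddCommGroup Y] [MeasurableSpace Y] [BorelSpace Y]
    [SecondCountableTopology Y] [Countable κ] [Nonempty κ] {p q : ℝ} (hp : 1 ≤ p)
    (hq : 1 ≤ q) (h : BorelReducible (ESum X p) (ESum Y q)) (d : κ → X) :
    ∃ C > 0, ∃ δ > 0, ∀ S : Finset κ, ∃ (F : Finset ℕ) (T : ℕ → κ → Y), ∀ a ∈ S, ∀ b ∈ S,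
      0 < ‖d a - d b‖ ^ p → ‖d a - d b‖ ^ p ≤ δ →
      ∑ m ∈ F, ‖T m a - T m b‖ ^ q ≤ C * ‖d a - d b‖ ^ p ∧
      ‖d a - d b‖ ^ p ≤ C * ∑ m ∈ F, ‖T m a - T m b‖ ^ q := by
  obtain ⟨f, hf⟩ := exists_surjective_nat κ
  have hf' : Function.Surjective (fun z : ℤ => f z.natAbs) := fun k => by
    obtain ⟨n, rfl⟩ := hf k
    exact ⟨n, by simp⟩
  obtain ⟨g, hg⟩ := hf'.hasRightInverse
  obtain ⟨F, T, hFT⟩ := block_form hp hq h (fun z : ℤ => d (f z.natAbs))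
  have h0q : (0:ℝ) ^ q = 0 := Real.zero_rpow (by linarith)
  have h0p : (0:ℝ) ^ p = 0 := Real.zero_rpow (by linarith)
  obtain ⟨C, hC, δ, hδ, hu⟩ := uniform_bounds
    (fun a b => ‖d (f a.natAbs) - d (f b.natAbs)‖ ^ p)
    (fun i a b => ∑ m ∈ F i, ‖T m a - T m b‖ ^ q) (by simp [h0p])
    (by simp [h0q]) (fun i a b => Finset.sum_nonneg fun _ _ => by positivity) hFT
  refine ⟨C, hC, δ, hδ, fun S => ?_⟩
  have : ∀ᶠ i in atTop, ∀ a ∈ S, ∀ b ∈ S, 0 < ‖d a - d b‖ ^ p → ‖d a - d b‖ ^ p ≤ δ →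
      ∑ m ∈ F i, ‖T m (g a) - T m (g b)‖ ^ q ≤ C * ‖d a - d b‖ ^ p ∧
      ‖d a - d b‖ ^ p ≤ C * ∑ m ∈ F i, ‖T m (g a) - T m (g b)‖ ^ q := by
    rw [Filter.eventually_all_finset]; intro a _
    rw [Filter.eventually_all_finset]; intro b _
    by_cases h1 : 0 < ‖d a - d b‖ ^ p ∧ ‖d a - d b‖ ^ p ≤ δ
    · have := hu (g a) (g b)
      have ha : f (g a).natAbs = a := hg a
      have hb : f (g b).natAbs = b := hg b
      simp only [ha, hb] at this
      filter_upwards [this h1.1 h1.2] with i hi _ _ using hi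
    · exact Eventually.of_forall fun i h2 h3 => absurd ⟨h2, h3⟩ h1
  obtain ⟨i, hi⟩ := this.exists
  exact ⟨F i, fun m k => T m (g k), hi⟩

lemma not_pow_bound {K x : ℝ} (hx : 0 < x) (h : ∀ N : ℕ, 0 < N → (N:ℝ) ^ x ≤ K) : False := by
  have h1 : Tendsto (fun N : ℕ => (N:ℝ) ^ x) atTop atTop :=
    (tendsto_rpow_atTop hx).comp tendsto_natCast_atTop_atTop
  obtain ⟨N, h2, h3⟩ := ((h1.eventually_gt_atTop K).and (eventually_gt_atTop 0)).exists
  linarith [h N h3]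

lemma nec_p {r s p q : ℝ} (hp : 1 ≤ p) (hq : 1 ≤ q)
    [Fact (1 ≤ ENNReal.ofReal r)] [Fact (1 ≤ ENNReal.ofReal s)]
    (h : BorelReducible (ESum (LSp r) p) (ESum (LSp s) q)) : p ≤ q := by
  have : Fact (ENNReal.ofReal s ≠ ⊤) := ⟨by simp⟩
  have : IsProbabilityMeasure ((volume : Measure ℝ).restrict (Set.Icc 0 1)) := ⟨by simp⟩
  have h1r : (1:ℝ≥0∞) ≤ ENNReal.ofReal r := Fact.out
  let one : LSp r := Lp.const _ _ (1:ℝ)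
  have hone : ‖one‖ = 1 := by
    simp only [one]
    have h0 : ENNReal.ofReal r ≠ 0 := by intro h; rw [h] at h1r; simp at h1r
    refine (Lp.norm_const (μ := (volume : Measure ℝ).restrict (Set.Icc 0 1)) (c := (1:ℝ)) (hp_zero := h0)).trans ?_
    simp [measureReal_def]
  obtain ⟨C, hC, δ, hδ, hu⟩ := finite_embed hp hq h (fun t : ℚ => (t:ℝ) • one)
  have hd : ∀ a b : ℚ, ‖(a:ℝ) • one - (b:ℝ) • one‖ ^ p = |(a:ℝ) - b| ^ p := fun a b => by
    rw [← sub_smul, norm_smul, hone, mul_one, Real.norm_eq_abs]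
  simp only [hd] at hu
  obtain ⟨η, hη0, hη⟩ : ∃ η : ℚ, 0 < η ∧ (η:ℝ) ^ p ≤ δ := by
    obtain ⟨η, h1, h2⟩ := exists_rat_btwn (show (0:ℝ) < δ ^ (p⁻¹) by positivity)
    refine ⟨η, by exact_mod_cast h1, ?_⟩
    calc (η:ℝ) ^ p ≤ (δ ^ p⁻¹) ^ p := Real.rpow_le_rpow h1.le h2.le (by linarith)
      _ = δ := by rw [← Real.rpow_mul hδ.le, inv_mul_cancel₀ (by linarith), Real.rpow_one]
  by_contra! hlt
  refine not_pow_bound (K := C ^ 2) (x := p - q) (by linarith) fun N hN => ?_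
  have hNr : (0:ℝ) < N := by exact_mod_cast hN
  have hηr : (0:ℝ) < η := by exact_mod_cast hη0
  let pt : ℕ → ℚ := fun j => j * η / N
  obtain ⟨F, T, hT⟩ := hu ((Finset.range (N+1)).image pt)
  have hmem : ∀ j ≤ N, pt j ∈ (Finset.range (N+1)).image pt := fun j hj =>
    Finset.mem_image_of_mem _ (by simp; omega)
  have hηp : 0 < (η:ℝ) ^ p := by positivity
  have e1 : |((pt 0 : ℚ):ℝ) - (pt N : ℚ)| ^ p = (η:ℝ) ^ p := by
    simp only [pt]; push_cast
    rw [mul_div_cancel_left₀ _ hNr.ne']; simp [abs_of_pos hηr]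
  have e2 : ∀ j, |((pt j : ℚ):ℝ) - (pt (j+1) : ℚ)| ^ p = ((η:ℝ) / N) ^ p := fun j => by
    simp only [pt]; push_cast
    rw [show (j * (η:ℝ) / N - (j + 1) * η / N) = - (η / N) by field_simp; ring, abs_neg,
      abs_of_pos (by positivity)]
  have b1 := (hT _ (hmem 0 (by omega)) _ (hmem N le_rfl) (by rw [e1]; exact hηp)
    (by rw [e1]; exact hη)).2
  have hle : ((η:ℝ) / N) ^ p ≤ δ := by
    refine le_trans (Real.rpow_le_rpow (by positivity) ?_ (by linarith)) hη
    exact div_le_self hηr.le (by exact_mod_cast hN)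
  have b2 : ∀ j < N, ∑ m ∈ F, ‖T m (pt j) - T m (pt (j+1))‖ ^ q ≤ C * ((η:ℝ) / N) ^ p :=
    fun j hj => by
      have := (hT _ (hmem j (by omega)) _ (hmem (j+1) (by omega)) (by rw [e2]; positivity)
        (by rw [e2]; exact hle)).1
      rwa [e2] at this
  have b3 : ∑ m ∈ F, ‖T m (pt 0) - T m (pt N)‖ ^ q ≤ (N:ℝ) ^ (q-1) * (N * (C * ((η:ℝ) / N) ^ p)) := by
    calc ∑ m ∈ F, ‖T m (pt 0) - T m (pt N)‖ ^ q
        ≤ ∑ m ∈ F, (N:ℝ) ^ (q-1) * ∑ j ∈ Finset.range N, ‖T m (pt j) - T m (pt (j+1))‖ ^ q := by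
          refine Finset.sum_le_sum fun m _ => ?_
          have := Real.rpow_sum_le_const_mul_sum_rpow_of_nonneg (s := Finset.range N)
            (f := fun j => ‖T m (pt j) - T m (pt (j+1))‖) hq (fun _ _ => norm_nonneg _)
          rw [Finset.card_range] at this
          refine le_trans (Real.rpow_le_rpow (norm_nonneg _) ?_ (by linarith)) this
          rw [← Finset.sum_range_sub' (fun j => T m (pt j)) N]
          exact norm_sum_le _ _
      _ = (N:ℝ) ^ (q-1) * ∑ j ∈ Finset.range N, ∑ m ∈ F, ‖T m (pt j) - T m (pt (j+1))‖ ^ q := by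
          rw [← Finset.mul_sum, Finset.sum_comm]
      _ ≤ (N:ℝ) ^ (q-1) * ∑ j ∈ Finset.range N, C * ((η:ℝ) / N) ^ p := by
          gcongr with j hj
          exact b2 j (by simpa using hj)
      _ = _ := by simp
  rw [e1] at b1
  have b4 : (η:ℝ) ^ p ≤ C * ((N:ℝ) ^ (q-1) * (N * (C * ((η:ℝ) / N) ^ p))) :=
    b1.trans (mul_le_mul_of_nonneg_left b3 hC.le)
  rw [Real.div_rpow hηr.le hNr.le] at b4
  have b5 : C * ((N:ℝ) ^ (q-1) * (N * (C * ((η:ℝ) ^ p / N ^ p)))) = C ^ 2 * η ^ p / N ^ (p - q) := by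
    rw [Real.rpow_sub hNr p q, Real.rpow_sub hNr q 1, Real.rpow_one]
    have : (0:ℝ) < N ^ p := by positivity
    have : (0:ℝ) < N ^ q := by positivity
    field_simp
  rw [b5, le_div_iff₀ (by positivity), mul_comm] at b4
  exact le_of_mul_le_mul_right b4 hηp

lemma exists_partition : ∃ J : ℝ → ℕ, Measurable J ∧
    ∀ j, ((volume : Measure ℝ).restrict (Set.Icc 0 1)) (J ⁻¹' {j}) ≠ 0 := by
  refine ⟨fun x => ⌊x⁻¹⌋₊ - 1, ?_, fun j => ?_⟩
  · exact (measurable_of_countable (fun n : ℕ => n - 1)).comp (Nat.measurable_floor.comp measurable_inv)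
  · have hj : (0:ℝ) < j + 1 := by positivity
    have hsub : Set.Ioo ((j:ℝ)+2)⁻¹ ((j:ℝ)+1)⁻¹ ⊆ ((fun x : ℝ => ⌊x⁻¹⌋₊ - 1) ⁻¹' {j}) ∩ Set.Icc 0 1 := by
      rintro x ⟨h1, h2⟩
      have hx : 0 < x := lt_trans (by positivity) h1
      have h3 : (j:ℝ) + 1 < x⁻¹ := (lt_inv_comm₀ hj hx).2 h2
      have h4 : x⁻¹ < (j:ℝ) + 2 := (inv_lt_comm₀ hx (by positivity)).2 h1
      refine ⟨?_, hx.le, ?_⟩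
      · have : ⌊x⁻¹⌋₊ = j + 1 := by
          rw [Nat.floor_eq_iff (by positivity)]
          push_cast
          constructor <;> linarith
        simp [this]
      · refine h2.le.trans (inv_le_one_of_one_le₀ (by linarith [Nat.cast_nonneg (α := ℝ) j]))
    have h5 : 0 < (volume : Measure ℝ) (Set.Ioo ((j:ℝ)+2)⁻¹ ((j:ℝ)+1)⁻¹) := by
      rw [Real.volume_Ioo]
      simp only [ENNReal.ofReal_pos, sub_pos]
      gcongr; norm_num
    rw [Measure.restrict_apply']
    · exact (lt_of_lt_of_le h5 (measure_mono hsub)).ne'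
    · exact measurableSet_Icc

lemma exists_cube {r : ℝ} (hr : 1 ≤ r) [Fact (1 ≤ ENNReal.ofReal r)] : ∃ φ : Finset ℕ → LSp r,
    ∀ A B, ‖φ A - φ B‖ ^ r = (symmDiff A B).card := by
  classical
  obtain ⟨J, hJ, hJ0⟩ := exists_partition
  set μ := (volume : Measure ℝ).restrict (Set.Icc 0 1) with hμ
  have hfin : ∀ j, μ (J ⁻¹' {j}) ≠ ⊤ := fun j => measure_ne_top _ _
  have hr0 : 0 < r := by linarith
  let w : ℕ → ℝ := fun j => ((μ (J ⁻¹' {j})).toReal)⁻¹ ^ (r⁻¹)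
  have hw : ∀ j, ENNReal.ofReal (|w j| ^ r) * μ (J ⁻¹' {j}) = 1 := fun j => by
    have h1 : 0 < (μ (J ⁻¹' {j})).toReal := ENNReal.toReal_pos (hJ0 j) (hfin j)
    rw [abs_of_nonneg (by positivity), ← Real.rpow_mul (by positivity), inv_mul_cancel₀ hr0.ne',
      Real.rpow_one, ENNReal.ofReal_inv_of_pos h1, ENNReal.ofReal_toReal (hfin j),
      ENNReal.inv_mul_cancel (hJ0 j) (hfin j)]
  let u : Finset ℕ → ℕ → ℝ := fun A j => if j ∈ A then w j else 0
  have hu : ∀ A, Measurable fun x => u A (J x) := fun A => (measurable_of_countable (u A)).comp hJ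
  have hub : ∀ A j, ‖u A j‖ ≤ ∑ i ∈ A, |w i| := fun A j => by
    simp only [u]; split_ifs with h
    · exact Finset.single_le_sum (f := fun i => |w i|) (fun i _ => abs_nonneg _) h
    · simpa using Finset.sum_nonneg fun i _ => abs_nonneg (w i)
  have hmem : ∀ A, MemLp (fun x => u A (J x)) (ENNReal.ofReal r) μ := fun A =>
    MemLp.of_bound (hu A).aestronglyMeasurable _ (Eventually.of_forall fun x => hub A _)
  refine ⟨fun A => (hmem A).toLp, fun A B => ?_⟩
  have key : ENNReal.ofReal (‖(hmem A).toLp - (hmem B).toLp‖ ^ r) = (symmDiff A B).card := by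
    rw [LSp_norm_rpow hr, ← MemLp.toLp_sub]
    have h1 : ∫⁻ x, ENNReal.ofReal (|((hmem A).sub (hmem B)).toLp _ x| ^ r) ∂μ =
        ∫⁻ x, (fun j => ENNReal.ofReal (|u A j - u B j| ^ r)) (J x) ∂μ := by
      refine lintegral_congr_ae ?_
      filter_upwards [((hmem A).sub (hmem B)).coeFn_toLp] with x hx
      rw [hx]; rfl
    rw [h1, ← lintegral_map (f := fun j => ENNReal.ofReal (|u A j - u B j| ^ r)) (measurable_of_countable _) hJ, lintegral_countable']
    have h2 : ∀ j, ENNReal.ofReal (|u A j - u B j| ^ r) * (μ.map J) {j} =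
        if j ∈ symmDiff A B then 1 else 0 := fun j => by
      rw [Measure.map_apply hJ (MeasurableSet.singleton j)]
      simp only [u, Finset.mem_symmDiff]
      by_cases hA : j ∈ A <;> by_cases hB : j ∈ B <;>
        simp [hA, hB, hw, Real.zero_rpow hr0.ne']
    rw [tsum_congr h2, tsum_eq_sum (s := symmDiff A B) (fun j hj => by simp [hj])]
    simp
  have h3 := congrArg ENNReal.toReal key
  rw [ENNReal.toReal_ofReal (by positivity)] at h3
  simpa using h3

lemma nec_r {r s p q : ℝ} (hr : 1 ≤ r) (hs : 1 ≤ s) (hs2 : s ≤ 2) (hp : 1 ≤ p) (hq : 1 ≤ q)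
    (hsq : s ≤ q)
    [Fact (1 ≤ ENNReal.ofReal r)] [Fact (1 ≤ ENNReal.ofReal s)]
    (h : BorelReducible (ESum (LSp r) p) (ESum (LSp s) q)) : s / q ≤ r / p := by
  classical
  have : Fact (ENNReal.ofReal s ≠ ⊤) := ⟨by simp⟩
  obtain ⟨φ, hφ⟩ := exists_cube hr
  have hr0 : 0 < r := by linarith
  have hs0 : 0 < s := by linarith
  have hp0 : 0 < p := by linarith
  have hq0 : 0 < q := by linarith
  obtain ⟨C, hC, δ, hδ, hu⟩ := finite_embed hp hq h
    (fun z : Finset ℕ × ℕ => ((z.2:ℝ)+1)⁻¹ • φ z.1)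
  have hd : ∀ (A B : Finset ℕ) (M : ℕ), ‖((M:ℝ)+1)⁻¹ • φ A - ((M:ℝ)+1)⁻¹ • φ B‖ ^ p =
      (((M:ℝ)+1)⁻¹) ^ p * ((symmDiff A B).card : ℝ) ^ (p / r) := fun A B M => by
    rw [← smul_sub, norm_smul, Real.mul_rpow (norm_nonneg _) (norm_nonneg _), ← hφ A B,
      ← Real.rpow_mul (norm_nonneg _), mul_div_cancel₀ _ hr0.ne', Real.norm_of_nonneg (by positivity)]
  obtain ⟨K, hK, hE⟩ := enflo_q (α := ℝ) (μ := (volume : Measure ℝ).restrict (Set.Icc 0 1)) hs hs2 hsq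
  by_contra! hlt
  have hlt' : q / s < p / r := by
    rw [div_lt_div_iff₀ hp0 hq0] at hlt
    rw [div_lt_div_iff₀ hs0 hr0]; linarith
  refine not_pow_bound (K := K * C ^ 2) (x := p / r - q / s) (by linarith) fun N hN => ?_
  have hNr : (0:ℝ) < N := by exact_mod_cast hN
  -- choose M
  obtain ⟨M, hM⟩ : ∃ M : ℕ, (((M:ℝ)+1)⁻¹) ^ p * (N:ℝ) ^ (p / r) ≤ δ := by
    have h1 : Tendsto (fun M : ℕ => ((M:ℝ)+1) ^ p) atTop atTop :=
      (tendsto_rpow_atTop hp0).comp (tendsto_atTop_add_const_right _ _ tendsto_natCast_atTop_atTop)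
    obtain ⟨M, hM⟩ := (h1.eventually_ge_atTop ((N:ℝ) ^ (p / r) / δ)).exists
    refine ⟨M, ?_⟩
    rw [Real.inv_rpow (by positivity), ← div_eq_inv_mul, div_le_iff₀ (by positivity)]
    rw [div_le_iff₀ hδ] at hM
    linarith
  set c : ℝ := (((M:ℝ)+1)⁻¹) ^ p with hc
  have hc0 : 0 < c := by positivity
  obtain ⟨F, T, hT⟩ := hu (((Finset.range N).powerset).image fun A => (A, M))
  simp only [Finset.mem_image, forall_exists_index, and_imp, forall_apply_eq_imp_iff₂,
    Finset.mem_powerset, hd] at hT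
  have hsd : ∀ A ⊆ Finset.range N, symmDiff A (Finset.range N \ A) = Finset.range N := by
    intro A hA; ext j; have := @hA j
    simp only [Finset.mem_symmDiff, Finset.mem_sdiff]; tauto
  have hsj : ∀ A : Finset ℕ, ∀ j, symmDiff A (symmDiff A {j}) = {j} := fun A j => by
    rw [← symmDiff_assoc, symmDiff_self, bot_symmDiff]
  have hsub : ∀ A ⊆ Finset.range N, ∀ j ∈ Finset.range N, symmDiff A {j} ⊆ Finset.range N := by
    intro A hA j hj k hk
    simp only [Finset.mem_symmDiff, Finset.mem_singleton] at hk
    rcases hk with hk | hk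
    · exact hA hk.1
    · rw [hk.1]; exact hj
  have b1 : ∀ A ⊆ Finset.range N, c * (N:ℝ) ^ (p / r) ≤
      C * ∑ m ∈ F, ‖T m (A, M) - T m (Finset.range N \ A, M)‖ ^ q := by
    intro A hA
    have := (hT A hA (Finset.range N \ A) Finset.sdiff_subset)
    rw [hsd A hA, Finset.card_range] at this
    exact (this (by positivity) hM).2
  have hcδ : c ≤ δ := by
    refine le_trans (le_mul_of_one_le_right hc0.le ?_) hM
    exact Real.one_le_rpow (by exact_mod_cast hN) (by positivity)
  have b2 : ∀ A ⊆ Finset.range N, ∀ j ∈ Finset.range N,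
      ∑ m ∈ F, ‖T m (A, M) - T m (symmDiff A {j}, M)‖ ^ q ≤ C * c := by
    intro A hA j hj
    have := (hT A hA (symmDiff A {j}) (hsub A hA j hj))
    rw [hsj A j, Finset.card_singleton, Nat.cast_one, Real.one_rpow, mul_one] at this
    exact (this hc0 hcδ).1
  have b3 : (2:ℝ) ^ N * (c * (N:ℝ) ^ (p / r)) ≤
      C * (K * (N:ℝ) ^ (q/s - 1) * ((2:ℝ) ^ N * (N * (C * c)))) := by
    calc (2:ℝ) ^ N * (c * (N:ℝ) ^ (p / r))
        = ∑ A ∈ (Finset.range N).powerset, c * (N:ℝ) ^ (p / r) := by simp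
      _ ≤ ∑ A ∈ (Finset.range N).powerset,
          C * ∑ m ∈ F, ‖T m (A, M) - T m (Finset.range N \ A, M)‖ ^ q :=
          Finset.sum_le_sum fun A hA => b1 A (Finset.mem_powerset.1 hA)
      _ = C * ∑ m ∈ F, ∑ A ∈ (Finset.range N).powerset,
            ‖T m (A, M) - T m (Finset.range N \ A, M)‖ ^ q := by
          rw [← Finset.mul_sum, Finset.sum_comm]
      _ ≤ C * ∑ m ∈ F, K * (N:ℝ) ^ (q/s - 1) * ∑ A ∈ (Finset.range N).powerset,
            ∑ j ∈ Finset.range N, ‖T m (A, M) - T m (symmDiff A {j}, M)‖ ^ q := by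
          gcongr with m hm
          exact hE N (fun A => T m (A, M))
      _ = C * (K * (N:ℝ) ^ (q/s - 1) * ∑ A ∈ (Finset.range N).powerset,
            ∑ j ∈ Finset.range N, ∑ m ∈ F, ‖T m (A, M) - T m (symmDiff A {j}, M)‖ ^ q) := by
          rw [← Finset.mul_sum, Finset.sum_comm]
          congr 2
          refine Finset.sum_congr rfl fun A _ => ?_
          rw [Finset.sum_comm]
      _ ≤ C * (K * (N:ℝ) ^ (q/s - 1) * ∑ A ∈ (Finset.range N).powerset,
            ∑ j ∈ Finset.range N, C * c) := by
          gcongr with A hA j hj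
          exact b2 A (Finset.mem_powerset.1 hA) j hj
      _ = _ := by simp
  have e1 : C * (K * (N:ℝ) ^ (q/s - 1) * ((2:ℝ) ^ N * (N * (C * c)))) =
      (K * C ^ 2 * (N:ℝ) ^ (q / s)) * (2 ^ N * c) := by
    rw [Real.rpow_sub hNr, Real.rpow_one]; field_simp
  rw [e1, show (2:ℝ) ^ N * (c * (N:ℝ) ^ (p / r)) = (N:ℝ) ^ (p / r) * (2 ^ N * c) by ring] at b3
  have b4 := le_of_mul_le_mul_right b3 (by positivity)
  rw [Real.rpow_sub hNr, div_le_iff₀ (by positivity)]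
  exact b4

lemma exists_prob_nat : ∃ ν : Measure ℕ, IsProbabilityMeasure ν ∧ ∀ n, ν {n} ≠ 0 := by
  refine ⟨Measure.sum fun n : ℕ => (2⁻¹ : ℝ≥0∞) ^ (n+1) • Measure.dirac n, ⟨?_⟩, fun n => ?_⟩
  · rw [Measure.sum_apply _ MeasurableSet.univ]
    simp only [Measure.smul_apply, measure_univ, smul_eq_mul, mul_one]
    rw [ENNReal.tsum_geometric_add_one, ENNReal.one_sub_inv_two, inv_inv]
    exact ENNReal.inv_mul_cancel (by simp) (by simp)
  · rw [Measure.sum_apply _ (MeasurableSet.singleton n)]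
    intro h
    have := ENNReal.tsum_eq_zero.1 h n
    simp at this

lemma trig_lower {x y : ℝ} {s : ℝ} (hs : 1 ≤ s) (h1 : 1 ≤ |x - y|) (h2 : |x - y| ≤ 2) :
    (1 - Real.cos 1) ^ (s/2) ≤ |Real.cos x - Real.cos y| ^ s + |Real.sin x - Real.sin y| ^ s := by
  have e : (Real.cos x - Real.cos y)^2 + (Real.sin x - Real.sin y)^2 = 2 - 2 * Real.cos |x - y| := by
    rw [Real.cos_abs, Real.cos_sub]
    nlinarith [Real.sin_sq_add_cos_sq x, Real.sin_sq_add_cos_sq y]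
  have hc : Real.cos |x - y| ≤ Real.cos 1 := by
    apply Real.cos_le_cos_of_nonneg_of_le_pi (by norm_num) _ h1
    linarith [Real.pi_gt_three]
  have hη : 0 ≤ 1 - Real.cos 1 := by linarith [Real.cos_le_one 1]
  have key : ∀ u : ℝ, 1 - Real.cos 1 ≤ u ^ 2 → (1 - Real.cos 1) ^ (s/2) ≤ |u| ^ s := fun u hu => by
    calc (1 - Real.cos 1) ^ (s/2) ≤ (|u| ^ 2) ^ (s/2) := 
          Real.rpow_le_rpow hη (by rwa [sq_abs]) (by linarith)
      _ = |u| ^ s := by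
          rw [← Real.rpow_natCast, ← Real.rpow_mul (abs_nonneg _)]; congr 1; push_cast; ring
  rcases le_total ((Real.cos x - Real.cos y)^2) ((Real.sin x - Real.sin y)^2) with h | h
  · have := key (Real.sin x - Real.sin y) (by linarith)
    have : 0 ≤ |Real.cos x - Real.cos y| ^ s := by positivity
    linarith
  · have := key (Real.cos x - Real.cos y) (by linarith)
    have : 0 ≤ |Real.sin x - Real.sin y| ^ s := by positivity
    linarith

lemma trig_upper {x y D s : ℝ} (hs : 0 ≤ s) (h : |x - y| ≤ D) :
    |Real.cos x - Real.cos y| ^ s + |Real.sin x - Real.sin y| ^ s ≤ 2 * (min 2 D) ^ s := by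
  have h1 : |Real.cos x - Real.cos y| ≤ min 2 D := by
    refine le_min ?_ (le_trans ?_ h)
    · have := abs_sub (Real.cos x) (Real.cos y)
      linarith [Real.abs_cos_le_one x, Real.abs_cos_le_one y]
    · simpa [Real.dist_eq] using (Real.lipschitzWith_cos).dist_le_mul x y
  have h2 : |Real.sin x - Real.sin y| ≤ min 2 D := by
    refine le_min ?_ (le_trans ?_ h)
    · have := abs_sub (Real.sin x) (Real.sin y)
      linarith [Real.abs_sin_le_one x, Real.abs_sin_le_one y]
    · simpa [Real.dist_eq] using (Real.lipschitzWith_sin).dist_le_mul x y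
  have := Real.rpow_le_rpow (abs_nonneg _) h1 hs
  have := Real.rpow_le_rpow (abs_nonneg _) h2 hs
  linarith

lemma dyadic_summable {t s : ℝ} (ht : 0 < t) (hts : t < s) :
    Summable fun j : ℤ => ((2:ℝ) ^ j) ^ t * (min 1 ((2:ℝ) ^ j)⁻¹) ^ s := by
  refine Summable.of_nat_of_neg ?_ ?_
  · have : Summable fun n : ℕ => ((2:ℝ) ^ (t - s)) ^ n :=
      summable_geometric_of_lt_one (by positivity)
        (Real.rpow_lt_one_of_one_lt_of_neg (by norm_num) (by linarith))
    refine this.congr fun n => ?_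
    have h1 : ((2:ℝ) ^ (n:ℤ))⁻¹ ≤ 1 := inv_le_one_of_one_le₀ (by simpa using one_le_pow₀ (by norm_num))
    rw [min_eq_right h1, zpow_natCast, Real.inv_rpow (by positivity), ← div_eq_mul_inv,
      ← Real.rpow_sub (by positivity), ← Real.rpow_natCast, ← Real.rpow_natCast,
      ← Real.rpow_mul (by norm_num), ← Real.rpow_mul (by norm_num), mul_comm]
  · have : Summable fun n : ℕ => ((2:ℝ) ^ (-t)) ^ n :=
      summable_geometric_of_lt_one (by positivity)
        (Real.rpow_lt_one_of_one_lt_of_neg (by norm_num) (by linarith))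
    refine this.congr fun n => ?_
    have h1 : 1 ≤ ((2:ℝ) ^ (-(n:ℤ)))⁻¹ := by
      simpa using one_le_pow₀ (by norm_num)
    rw [min_eq_left h1, Real.one_rpow, mul_one, zpow_neg, zpow_natCast, Real.inv_rpow (by positivity),
      ← Real.rpow_natCast, ← Real.rpow_natCast, 
      ← Real.rpow_mul (by norm_num), ← Real.rpow_mul (by norm_num), ← Real.rpow_neg (by norm_num)]
    congr 1; ring

lemma dyadic_bounds {t s : ℝ} (ht : 0 < t) (hts : t < s) (hs : 1 ≤ s) :
    ∃ c > 0, ∃ C > 0, ∀ a b : ℝ, 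
      ENNReal.ofReal (c * |a - b| ^ t) ≤ ∑' k : ℤ, ENNReal.ofReal (((2:ℝ) ^ k) ^ t *
        (|Real.cos (a / 2 ^ k) - Real.cos (b / 2 ^ k)| ^ s +
         |Real.sin (a / 2 ^ k) - Real.sin (b / 2 ^ k)| ^ s)) ∧
      ∑' k : ℤ, ENNReal.ofReal (((2:ℝ) ^ k) ^ t *
        (|Real.cos (a / 2 ^ k) - Real.cos (b / 2 ^ k)| ^ s +
         |Real.sin (a / 2 ^ k) - Real.sin (b / 2 ^ k)| ^ s)) ≤ ENNReal.ofReal (C * |a - b| ^ t) := by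
  have hsum := dyadic_summable ht hts
  set K0 := ∑' j : ℤ, ((2:ℝ) ^ j) ^ t * (min 1 ((2:ℝ) ^ j)⁻¹) ^ s with hK0
  have hnn : ∀ j : ℤ, 0 ≤ ((2:ℝ) ^ j) ^ t * (min 1 ((2:ℝ) ^ j)⁻¹) ^ s := fun j => by
    have : 0 ≤ min 1 ((2:ℝ) ^ j)⁻¹ := by positivity
    positivity
  have hK0p : 0 ≤ K0 := tsum_nonneg hnn
  have hη : 0 < 1 - Real.cos 1 := by linarith [Real.cos_one_le]
  refine ⟨(1 - Real.cos 1) ^ (s/2) * (2 ^ t)⁻¹, by positivity, 2 * 2 ^ s * K0 + 1, by positivity,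
    fun a b => ?_⟩
  have h0t : (0:ℝ) ^ t = 0 := Real.zero_rpow ht.ne'
  have h0s : (0:ℝ) ^ s = 0 := Real.zero_rpow (by linarith)
  rcases eq_or_ne a b with rfl | hab
  · simp [h0t, h0s]
  have hD : 0 < |a - b| := abs_pos.2 (sub_ne_zero.2 hab)
  obtain ⟨k0, hk1, hk2⟩ := exists_mem_Ico_zpow hD (one_lt_two)
  have habs : ∀ k : ℤ, |a / 2 ^ k - b / 2 ^ k| = |a - b| / 2 ^ k := fun k => by
    rw [← sub_div, abs_div, abs_of_pos (a := (2:ℝ) ^ k) (by positivity)]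
  have h2k : (0:ℝ) < 2 ^ k0 := by positivity
  have hk2' : |a - b| ≤ 2 * 2 ^ k0 := by rw [zpow_add_one₀ (by norm_num)] at hk2; linarith
  constructor
  · refine le_trans ?_ (ENNReal.le_tsum k0)
    refine ENNReal.ofReal_le_ofReal ?_
    have h3 := trig_lower (x := a / 2 ^ k0) (y := b / 2 ^ k0) hs
      (by rw [habs, le_div_iff₀ h2k]; linarith) (by rw [habs, div_le_iff₀ h2k]; linarith)
    have h4 : |a - b| ^ t ≤ 2 ^ t * ((2:ℝ) ^ k0) ^ t := by
      rw [← Real.mul_rpow (by norm_num) h2k.le]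
      exact Real.rpow_le_rpow hD.le hk2' ht.le
    calc (1 - Real.cos 1) ^ (s/2) * (2 ^ t)⁻¹ * |a - b| ^ t 
        ≤ (1 - Real.cos 1) ^ (s/2) * (2 ^ t)⁻¹ * (2 ^ t * ((2:ℝ) ^ k0) ^ t) := by gcongr
      _ = ((2:ℝ) ^ k0) ^ t * (1 - Real.cos 1) ^ (s/2) := by
          have : (0:ℝ) < 2 ^ t := by positivity
          field_simp
      _ ≤ _ := by gcongr
  · rw [← (Equiv.addRight k0).tsum_eq (fun k : ℤ => ENNReal.ofReal (((2:ℝ) ^ k) ^ t *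
        (|Real.cos (a / 2 ^ k) - Real.cos (b / 2 ^ k)| ^ s +
         |Real.sin (a / 2 ^ k) - Real.sin (b / 2 ^ k)| ^ s)))]
    have h5 : ((2:ℝ) ^ k0) ^ t ≤ |a - b| ^ t := Real.rpow_le_rpow h2k.le hk1 ht.le
    have h6 : ∀ j : ℤ, ((2:ℝ) ^ (j + k0)) ^ t *
        (|Real.cos (a / 2 ^ (j + k0)) - Real.cos (b / 2 ^ (j + k0))| ^ s +
         |Real.sin (a / 2 ^ (j + k0)) - Real.sin (b / 2 ^ (j + k0))| ^ s) ≤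
        2 * 2 ^ s * |a - b| ^ t * (((2:ℝ) ^ j) ^ t * (min 1 ((2:ℝ) ^ j)⁻¹) ^ s) := fun j => by
      have h7 := trig_upper (x := a / 2 ^ (j + k0)) (y := b / 2 ^ (j + k0)) (s := s) (by linarith)
        (D := 2 * ((2:ℝ) ^ j)⁻¹) (by
          rw [habs, zpow_add₀ (by norm_num), div_le_iff₀ (by positivity)]
          have : (0:ℝ) < 2 ^ j := by positivity
          field_simp; linarith)
      have h8 : min 2 (2 * ((2:ℝ) ^ j)⁻¹) = 2 * min 1 ((2:ℝ) ^ j)⁻¹ := by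
        rw [mul_min_of_nonneg _ _ (by norm_num : (0:ℝ) ≤ 2), mul_one]
      have h9 : 0 ≤ min 1 ((2:ℝ) ^ j)⁻¹ := by positivity
      rw [h8, Real.mul_rpow (by norm_num) h9] at h7
      calc _ ≤ ((2:ℝ) ^ (j + k0)) ^ t * (2 * (2 ^ s * (min 1 ((2:ℝ) ^ j)⁻¹) ^ s)) := by gcongr
        _ = 2 * 2 ^ s * ((2:ℝ) ^ k0) ^ t * (((2:ℝ) ^ j) ^ t * (min 1 ((2:ℝ) ^ j)⁻¹) ^ s) := by
            rw [zpow_add₀ (by norm_num), Real.mul_rpow (by positivity) (by positivity)]; ring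
        _ ≤ _ := by gcongr
    calc _ ≤ ∑' j : ℤ, ENNReal.ofReal (2 * 2 ^ s * |a - b| ^ t *
            (((2:ℝ) ^ j) ^ t * (min 1 ((2:ℝ) ^ j)⁻¹) ^ s)) :=
          ENNReal.tsum_le_tsum fun j => ENNReal.ofReal_le_ofReal (h6 j)
      _ = ENNReal.ofReal (2 * 2 ^ s * |a - b| ^ t * K0) := by
          rw [hK0, ← tsum_mul_left, ENNReal.ofReal_tsum_of_nonneg]
          · exact fun j => mul_nonneg (by positivity) (hnn j)
          · exact hsum.mul_left _
      _ ≤ _ := by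
          refine ENNReal.ofReal_le_ofReal ?_
          have : 0 ≤ |a - b| ^ t := by positivity
          nlinarith

lemma S_map {t s : ℝ} (ht : 0 < t) (hts : t ≤ s) (hs : 1 ≤ s) :
    ∃ (ν : Measure ℕ) (_ : IsProbabilityMeasure ν) (S : ℝ → ℕ → ℝ),
      Measurable (Function.uncurry S) ∧ S 0 = 0 ∧ ∃ c > 0, ∃ C > 0, ∀ a b : ℝ,
      ENNReal.ofReal (c * |a - b| ^ t) ≤ ∫⁻ n, ENNReal.ofReal (|S a n - S b n| ^ s) ∂ν ∧
      ∫⁻ n, ENNReal.ofReal (|S a n - S b n| ^ s) ∂ν ≤ ENNReal.ofReal (C * |a - b| ^ t) := by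
  obtain ⟨ν, hν, hν0⟩ := exists_prob_nat
  rcases hts.eq_or_lt with rfl | hts
  · refine ⟨ν, hν, fun a _ => a, measurable_fst, rfl, 1, one_pos, 1, one_pos, fun a b => ?_⟩
    simp
  obtain ⟨c, hc, C, hC, hb⟩ := dyadic_bounds ht hts hs
  have : Denumerable (ℤ × Bool) := (nonempty_denumerable _).some
  let ε : ℕ ≃ ℤ × Bool := (Denumerable.eqv (ℤ × Bool)).symm
  let w : ℕ → ℝ := fun n => ((((2:ℝ) ^ (ε n).1) ^ t) * ((ν {n}).toReal)⁻¹) ^ (s⁻¹)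
  let tr : ℤ × Bool → ℝ → ℝ := fun z a => if z.2 then Real.cos (a / 2 ^ z.1) - 1 else
    Real.sin (a / 2 ^ z.1)
  refine ⟨ν, hν, fun a n => w n * tr (ε n) a, ?_, ?_, c, hc, C, hC, fun a b => ?_⟩
  · refine measurable_from_prod_countable_left fun n => ?_
    change Measurable fun a => w n * tr (ε n) a
    simp only [tr]
    split_ifs <;> fun_prop
  · funext n; simp [tr]
  have key : ∫⁻ n, ENNReal.ofReal (|w n * tr (ε n) a - w n * tr (ε n) b| ^ s) ∂ν =
      ∑' k : ℤ, ENNReal.ofReal (((2:ℝ) ^ k) ^ t *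
        (|Real.cos (a / 2 ^ k) - Real.cos (b / 2 ^ k)| ^ s +
         |Real.sin (a / 2 ^ k) - Real.sin (b / 2 ^ k)| ^ s)) := by
    rw [lintegral_countable']
    have h1 : ∀ n, ENNReal.ofReal (|w n * tr (ε n) a - w n * tr (ε n) b| ^ s) * ν {n} =
        (fun z : ℤ × Bool => ENNReal.ofReal (((2:ℝ) ^ z.1) ^ t * |tr z a - tr z b| ^ s)) (ε n) := by
      intro n
      have h2 : 0 < (ν {n}).toReal := ENNReal.toReal_pos (hν0 n) (measure_ne_top _ _)
      rw [← mul_sub, abs_mul, Real.mul_rpow (abs_nonneg _) (abs_nonneg _),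
        abs_of_nonneg (a := w n) (by positivity), ← Real.rpow_mul (by positivity),
        inv_mul_cancel₀ (by linarith), Real.rpow_one]
      nth_rewrite 2 [← ENNReal.ofReal_toReal (measure_ne_top ν {n})]
      rw [← ENNReal.ofReal_mul (by positivity)]
      congr 1
      field_simp
    rw [tsum_congr h1, ε.tsum_eq (fun z : ℤ × Bool => ENNReal.ofReal (((2:ℝ) ^ z.1) ^ t * |tr z a - tr z b| ^ s)),
      ENNReal.tsum_prod']
    refine tsum_congr fun k => ?_
    rw [tsum_bool, ← ENNReal.ofReal_add (by positivity) (by positivity)]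
    simp only [tr, Bool.false_eq_true, if_false, if_true]
    congr 1
    rw [sub_sub_sub_cancel_right]; ring
  rw [key]
  exact hb a b

lemma gauss_law (A : Finset ℕ) (c : ℕ → ℝ) :
    (Measure.infinitePi (fun _ : ℕ => ProbabilityTheory.gaussianReal 0 1)).map
      (∑ i ∈ A, fun g : ℕ → ℝ => c i * g i) =
    ProbabilityTheory.gaussianReal 0 (Real.toNNReal (∑ i ∈ A, c i ^ 2)) := by
  classical
  set P := Measure.infinitePi (fun _ : ℕ => ProbabilityTheory.gaussianReal 0 1)
  induction A using Finset.induction_on with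
  | empty =>
    simp only [Finset.sum_empty, Real.toNNReal_zero, ProbabilityTheory.gaussianReal_zero_var]
    change P.map (fun _ => (0:ℝ)) = _
    rw [Measure.map_const]; simp
  | insert i A hi ih =>
    have hind : ProbabilityTheory.iIndepFun (fun i (g : ℕ → ℝ) => c i * g i) P :=
      ProbabilityTheory.iIndepFun_infinitePi (X := fun i (x:ℝ) => c i * x) (by fun_prop)
    have h1 := (hind.indepFun_finsetSum_of_notMem (by fun_prop) hi).symm
    have h2 : P.map (fun g : ℕ → ℝ => c i * g i) =
        ProbabilityTheory.gaussianReal 0 (Real.toNNReal (c i ^ 2)) := by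
      have : P.map (fun g : ℕ → ℝ => g i) = ProbabilityTheory.gaussianReal 0 1 :=
        Measure.infinitePi_map_eval _ i
      have h3 := ProbabilityTheory.gaussianReal_map_const_mul (μ := 0) (v := 1) (c i)
      rw [← this, Measure.map_map (by fun_prop) (by fun_prop)] at h3
      refine h3.trans ?_
      rw [mul_zero, mul_one]; congr 1
      ext; simp [sq_nonneg]
    rw [Finset.sum_insert hi, Finset.sum_insert hi,
      ProbabilityTheory.gaussianReal_add_gaussianReal_of_indepFun h1 h2 ih, add_zero,
      Real.toNNReal_add (sq_nonneg _) (Finset.sum_nonneg fun _ _ => sq_nonneg _)]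

lemma gauss_moment {t : ℝ} (ht : 0 < t) : ∃ K > 0, ∀ (A : Finset ℕ) (c : ℕ → ℝ),
    ∫⁻ g, ENNReal.ofReal (|∑ i ∈ A, c i * g i| ^ t)
      ∂(Measure.infinitePi (fun _ : ℕ => ProbabilityTheory.gaussianReal 0 1)) =
    ENNReal.ofReal (K * (∑ i ∈ A, c i ^ 2) ^ (t / 2)) := by
  set K0 := ∫⁻ x, ENNReal.ofReal (|x| ^ t) ∂(ProbabilityTheory.gaussianReal 0 1) with hK0
  have hfin : K0 ≠ ⊤ := by
    have h1 := (ProbabilityTheory.memLp_id_gaussianReal (μ := 0) (v := 1) (Real.toNNReal t))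
    have h2 := h1.eLpNorm_lt_top
    rw [eLpNorm_lt_top_iff_lintegral_rpow_enorm_lt_top (by simpa using ht) (by simp)] at h2
    refine ne_of_lt (lt_of_eq_of_lt (lintegral_congr fun x => ?_) h2)
    rw [ENNReal.coe_toReal, Real.coe_toNNReal _ ht.le, id, Real.enorm_eq_ofReal_abs,
      ENNReal.ofReal_rpow_of_nonneg (abs_nonneg _) ht.le]
  have hpos : K0 ≠ 0 := by
    intro h0
    rw [hK0, lintegral_eq_zero_iff (by fun_prop)] at h0
    have := ProbabilityTheory.nullSingletonClass_gaussianReal (μ := 0) (v := 1) (by simp)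
    have h1 : ∀ᵐ x ∂(ProbabilityTheory.gaussianReal 0 1), x ≠ 0 := by
      simp only [ae_iff, not_not, Set.setOf_eq_eq_singleton]; exact measure_singleton _
    obtain ⟨x, hx, hx'⟩ := (h0.and h1).exists
    have : 0 < |x| ^ t := Real.rpow_pos_of_pos (abs_pos.2 hx') _
    simp at hx
    linarith
  refine ⟨K0.toReal, ENNReal.toReal_pos hpos hfin, fun A c => ?_⟩
  set v := ∑ i ∈ A, c i ^ 2 with hv
  have hv0 : 0 ≤ v := Finset.sum_nonneg fun _ _ => sq_nonneg _
  have h1 := gauss_law A c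
  have h2 : ProbabilityTheory.gaussianReal 0 (Real.toNNReal v) =
      (ProbabilityTheory.gaussianReal 0 1).map (Real.sqrt v * ·) := by
    rw [ProbabilityTheory.gaussianReal_map_const_mul, mul_zero, mul_one]
    congr 1
    ext; simp [hv0]
  rw [h2] at h1
  have h3 : ∫⁻ g, ENNReal.ofReal (|∑ i ∈ A, c i * g i| ^ t)
      ∂(Measure.infinitePi (fun _ : ℕ => ProbabilityTheory.gaussianReal 0 1)) =
      ∫⁻ x, ENNReal.ofReal (|x| ^ t) ∂((Measure.infinitePi (fun _ : ℕ => ProbabilityTheory.gaussianReal 0 1)).map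
      (∑ i ∈ A, fun g : ℕ → ℝ => c i * g i)) := by
    rw [lintegral_map (by fun_prop) (by fun_prop)]
    simp
  rw [h3, h1, lintegral_map (by fun_prop) (by fun_prop), mul_comm,
    ENNReal.ofReal_mul (by positivity), ENNReal.ofReal_toReal hfin, hK0,
    ← lintegral_const_mul _ (by fun_prop)]
  refine lintegral_congr fun x => ?_
  rw [← ENNReal.ofReal_mul (by positivity), abs_mul, abs_of_nonneg (Real.sqrt_nonneg _),
    Real.mul_rpow (by positivity) (by positivity), Real.sqrt_eq_rpow, ← Real.rpow_mul hv0]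
  congr 3; ring

lemma exists_transfer {Y : Type*} [MeasurableSpace Y] [StandardBorelSpace Y] [Nonempty Y]
    (μ : Measure Y) [IsProbabilityMeasure μ] :
    ∃ φ : ℝ → Y, MeasurePreserving φ ((volume : Measure ℝ).restrict (Set.Icc 0 1)) μ := by
  obtain ⟨f, hf, hm⟩ := Measure.exists_measurable_map_eq μ
  have hp : Measurable (Set.projIcc (0:ℝ) 1 zero_le_one) := continuous_projIcc.measurable
  refine ⟨f ∘ Set.projIcc 0 1 zero_le_one, hf.comp hp, ?_⟩
  rw [← map_comap_subtype_coe measurableSet_Icc,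
    Measure.map_map (hf.comp hp) measurable_subtype_coe]
  have : (f ∘ Set.projIcc (0:ℝ) 1 zero_le_one) ∘ ((↑) : Set.Icc (0:ℝ) 1 → ℝ) = f := by
    funext x; simp
  rw [this]
  exact hm

lemma pair_bound {Ω : Type*} [MeasurableSpace Ω] (P : Measure Ω) [IsProbabilityMeasure P]
    {t s : ℝ} (ht : 0 < t)
    {ν : Measure ℕ} [IsProbabilityMeasure ν] {S : ℝ → ℕ → ℝ} (hS : Measurable (Function.uncurry S))
    {c C K : ℝ} (hc : 0 < c) (hC : 0 < C) (hK : 0 < K)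
    (hSb : ∀ a b : ℝ,
      ENNReal.ofReal (c * |a - b| ^ t) ≤ ∫⁻ n, ENNReal.ofReal (|S a n - S b n| ^ s) ∂ν ∧
      ∫⁻ n, ENNReal.ofReal (|S a n - S b n| ^ s) ∂ν ≤ ENNReal.ofReal (C * |a - b| ^ t))
    (hG : ∀ (A : Finset ℕ) (c : ℕ → ℝ),
      ∫⁻ g, ENNReal.ofReal (|∑ i ∈ A, c i * g i| ^ t)
        ∂(Measure.infinitePi (fun _ : ℕ => ProbabilityTheory.gaussianReal 0 1)) =
      ENNReal.ofReal (K * (∑ i ∈ A, c i ^ 2) ^ (t / 2)))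
    (A : Finset ℕ) (α β : ℕ → Ω → ℝ) (hα : ∀ i, Measurable (α i)) (hβ : ∀ i, Measurable (β i)) :
    ENNReal.ofReal (c * K) * ∫⁻ ω, (∑ i ∈ A, ENNReal.ofReal ((α i ω - β i ω) ^ 2)) ^ (t / 2) ∂P ≤
      ∫⁻ z : Ω × (ℕ → ℝ) × ℕ, ENNReal.ofReal (|S (∑ i ∈ A, α i z.1 * z.2.1 i) z.2.2 -
        S (∑ i ∈ A, β i z.1 * z.2.1 i) z.2.2| ^ s)
        ∂(P.prod ((Measure.infinitePi (fun _ : ℕ => ProbabilityTheory.gaussianReal 0 1)).prod ν)) ∧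
    ∫⁻ z : Ω × (ℕ → ℝ) × ℕ, ENNReal.ofReal (|S (∑ i ∈ A, α i z.1 * z.2.1 i) z.2.2 -
        S (∑ i ∈ A, β i z.1 * z.2.1 i) z.2.2| ^ s)
        ∂(P.prod ((Measure.infinitePi (fun _ : ℕ => ProbabilityTheory.gaussianReal 0 1)).prod ν)) ≤
    ENNReal.ofReal (C * K) * ∫⁻ ω, (∑ i ∈ A, ENNReal.ofReal ((α i ω - β i ω) ^ 2)) ^ (t / 2) ∂P := by
  have hm : ∀ γ : ℕ → Ω → ℝ, (∀ i, Measurable (γ i)) →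
      Measurable fun z : Ω × (ℕ → ℝ) × ℕ => S (∑ i ∈ A, γ i z.1 * z.2.1 i) z.2.2 := by
    intro γ hγ
    refine hS.comp (Measurable.prodMk ?_ (by fun_prop))
    refine Finset.measurable_sum _ fun i _ => ?_
    have := hγ i
    fun_prop
  have hmα := hm α hα
  have hmβ := hm β hβ
  have hF : Measurable fun z : Ω × (ℕ → ℝ) × ℕ =>
      ENNReal.ofReal (|S (∑ i ∈ A, α i z.1 * z.2.1 i) z.2.2 -
        S (∑ i ∈ A, β i z.1 * z.2.1 i) z.2.2| ^ s) := by
    exact (((measurable_abs.comp (hmα.sub hmβ))).pow_const s).ennreal_ofReal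
  rw [lintegral_prod _ hF.aemeasurable]
  have key : ∀ (k : ℝ), 0 < k → ∀ ω,
      ∫⁻ g, ENNReal.ofReal (k * |∑ i ∈ A, α i ω * g i - ∑ i ∈ A, β i ω * g i| ^ t)
        ∂(Measure.infinitePi (fun _ : ℕ => ProbabilityTheory.gaussianReal 0 1)) =
      ENNReal.ofReal (k * K) * (∑ i ∈ A, ENNReal.ofReal ((α i ω - β i ω) ^ 2)) ^ (t / 2) := by
    intro k hk ω
    have : ∀ g : ℕ → ℝ, ENNReal.ofReal (k * |∑ i ∈ A, α i ω * g i - ∑ i ∈ A, β i ω * g i| ^ t) =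
        ENNReal.ofReal k * ENNReal.ofReal (|∑ i ∈ A, (α i ω - β i ω) * g i| ^ t) := by
      intro g
      rw [ENNReal.ofReal_mul hk.le, ← Finset.sum_sub_distrib]
      simp only [sub_mul]
    simp_rw [this]
    rw [lintegral_const_mul _ (by fun_prop), hG A fun i => α i ω - β i ω,
      ← ENNReal.ofReal_sum_of_nonneg (fun i _ => sq_nonneg _),
      ENNReal.ofReal_rpow_of_nonneg (Finset.sum_nonneg fun _ _ => sq_nonneg _) (by positivity),
      ENNReal.ofReal_mul hK.le, ENNReal.ofReal_mul hk.le, mul_assoc]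
  have hΦ : Measurable fun ω => (∑ i ∈ A, ENNReal.ofReal ((α i ω - β i ω) ^ 2)) ^ (t / 2) := by
    refine Measurable.pow_const (Finset.measurable_sum _ fun i _ => ?_) _
    have := hα i; have := hβ i
    fun_prop
  have inner : ∀ ω, ∫⁻ y : (ℕ → ℝ) × ℕ, ENNReal.ofReal (|S (∑ i ∈ A, α i ω * y.1 i) y.2 -
        S (∑ i ∈ A, β i ω * y.1 i) y.2| ^ s)
        ∂((Measure.infinitePi (fun _ : ℕ => ProbabilityTheory.gaussianReal 0 1)).prod ν) =
      ∫⁻ g, ∫⁻ n, ENNReal.ofReal (|S (∑ i ∈ A, α i ω * g i) n -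
        S (∑ i ∈ A, β i ω * g i) n| ^ s) ∂ν
        ∂(Measure.infinitePi (fun _ : ℕ => ProbabilityTheory.gaussianReal 0 1)) := by
    intro ω
    rw [lintegral_prod]
    exact (hF.comp measurable_prodMk_left).aemeasurable
  rw [← lintegral_const_mul _ hΦ, ← lintegral_const_mul _ hΦ]
  constructor
  · refine lintegral_mono fun ω => ?_
    rw [← key c hc ω, inner]
    exact lintegral_mono fun g => (hSb _ _).1
  · refine lintegral_mono fun ω => ?_
    rw [← key C hC ω, inner]
    exact lintegral_mono fun g => (hSb _ _).2

lemma assembly {X : Type*} [NormedAddCommGroup X] {Ω : Type*} [MeasurableSpace Ω]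
    [StandardBorelSpace Ω] [Nonempty Ω] (P : Measure Ω) [IsProbabilityMeasure P]
    {t s : ℝ} (ht : 0 < t) (hts : t ≤ s) (hs : 1 ≤ s) [Fact (1 ≤ ENNReal.ofReal s)]
    (a : X → ℕ → Ω → ℝ) (ha : ∀ f i, Measurable (a f i))
    (hsub : ∀ f g i, ∀ᵐ ω ∂P, a f i ω - a g i ω = a (f - g) i ω)
    {c C : ℝ} (hc : 0 < c) (hC : 0 < C)
    (hb : ∀ f, ENNReal.ofReal (c * ‖f‖ ^ t) ≤
      ∫⁻ ω, (∑' i, ENNReal.ofReal ((a f i ω) ^ 2)) ^ (t / 2) ∂P ∧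
      ∫⁻ ω, (∑' i, ENNReal.ofReal ((a f i ω) ^ 2)) ^ (t / 2) ∂P ≤ ENNReal.ofReal (C * ‖f‖ ^ t)) :
    ∃ T : X → LSp s, ∃ c > 0, ∃ C > 0, ∀ f g,
      c * ‖f - g‖ ^ t ≤ ‖T f - T g‖ ^ s ∧ ‖T f - T g‖ ^ s ≤ C * ‖f - g‖ ^ t := by
  have hs0 : 0 < s := by linarith
  obtain ⟨ν, hν, S, hS, hS0, c1, hc1, C1, hC1, hSb⟩ := S_map ht hts hs
  obtain ⟨K, hK, hG⟩ := gauss_moment ht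
  set γ := Measure.infinitePi (fun _ : ℕ => ProbabilityTheory.gaussianReal 0 1) with hγ
  set μ := P.prod (γ.prod ν) with hμ
  have hpair := pair_bound P ht hS hc1 hC1 hK hSb hG
  rw [← hγ, ← hμ] at hpair
  let W : X → ℕ → Ω × (ℕ → ℝ) × ℕ → ℝ := fun f N z =>
    S (∑ i ∈ Finset.range N, a f i z.1 * z.2.1 i) z.2.2
  have hW : ∀ f N, Measurable (W f N) := by
    intro f N
    have h : Measurable fun z : Ω × (ℕ → ℝ) × ℕ =>
        ∑ i ∈ Finset.range N, a f i z.1 * z.2.1 i := by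
      refine Finset.measurable_sum _ fun i _ => ?_
      have := ha f i
      fun_prop
    have h' : Measurable fun z : Ω × (ℕ → ℝ) × ℕ => z.2.2 := by fun_prop
    exact hS.comp (h.prodMk h')
  let J : X → ℝ≥0∞ := fun f => ∫⁻ ω, (∑' i, ENNReal.ofReal ((a f i ω) ^ 2)) ^ (t / 2) ∂P
  have hJ : ∀ f, J f ≠ ⊤ := fun f => ne_top_of_le_ne_top ENNReal.ofReal_ne_top (hb f).2
  have hmem : ∀ f N, MemLp (W f N) (ENNReal.ofReal s) μ := by
    intro f N
    refine ⟨(hW f N).aestronglyMeasurable, ?_⟩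
    rw [eLpNorm_lt_top_iff_lintegral_rpow_enorm_lt_top (by simpa using hs0) (by simp)]
    have h1 := (hpair (Finset.range N) (a f) (fun _ _ => 0) (ha f) (fun _ => measurable_const)).2
    refine lt_of_le_of_lt (le_trans (le_of_eq (lintegral_congr fun z => ?_)) (h1.trans
      (mul_le_mul_right (lintegral_mono (g := fun ω =>
        (∑' i, ENNReal.ofReal ((a f i ω) ^ 2)) ^ (t / 2)) fun ω => ?_) _)))
      (ENNReal.mul_lt_top ENNReal.ofReal_lt_top (hJ f).lt_top)
    · rw [ENNReal.toReal_ofReal hs0.le, Real.enorm_eq_ofReal_abs,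
        ENNReal.ofReal_rpow_of_nonneg (abs_nonneg _) hs0.le]
      simp [W, hS0]
    · simp only [sub_zero]
      exact ENNReal.rpow_le_rpow (ENNReal.sum_le_tsum _) (by positivity)
  let u : X → ℕ → Lp ℝ (ENNReal.ofReal s) μ := fun f N => (hmem f N).toLp
  have hnorm : ∀ f g N M, ENNReal.ofReal (‖u f N - u g M‖ ^ s) =
      ∫⁻ z, ENNReal.ofReal (|W f N z - W g M z| ^ s) ∂μ := by
    intro f g N M
    rw [LSp_norm_rpow hs]
    refine lintegral_congr_ae ?_
    filter_upwards [Lp.coeFn_sub (u f N) (u g M), (hmem f N).coeFn_toLp, (hmem g M).coeFn_toLp]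
      with z h1 h2 h3
    rw [h1, Pi.sub_apply, h2, h3]
  -- tails
  let ε : X → ℕ → ℝ≥0∞ := fun f M =>
    ∫⁻ ω, (∑' i, ENNReal.ofReal ((a f (i + M) ω) ^ 2)) ^ (t / 2) ∂P
  have hmeas : ∀ f M, Measurable fun ω => (∑' i, ENNReal.ofReal ((a f (i + M) ω) ^ 2)) ^ (t / 2) := by
    intro f M
    refine Measurable.pow_const (Measurable.tsum fun i => ?_) _
    have := ha f (i + M)
    fun_prop
  have hε : ∀ f, Tendsto (ε f) atTop (𝓝 0) := by
    intro f
    have hm0 : Measurable fun ω => (∑' i, ENNReal.ofReal ((a f i ω) ^ 2)) ^ (t / 2) := hmeas f 0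
    have := tendsto_lintegral_of_dominated_convergence (μ := P)
      (F := fun M ω => (∑' i, ENNReal.ofReal ((a f (i + M) ω) ^ 2)) ^ (t / 2)) (f := fun _ => 0)
      (fun ω => (∑' i, ENNReal.ofReal ((a f i ω) ^ 2)) ^ (t / 2)) (hmeas f)
      (fun M => ae_of_all _ fun ω => ENNReal.rpow_le_rpow
        (ENNReal.tsum_comp_le_tsum_of_injective (add_left_injective M) _) (by positivity)) (hJ f) ?_
    · simpa using this
    · filter_upwards [ae_lt_top hm0 (hJ f)] with ω hω
      have h1 : ∑' i, ENNReal.ofReal ((a f i ω) ^ 2) ≠ ⊤ := by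
        intro h; rw [h, ENNReal.top_rpow_of_pos (by positivity)] at hω; exact lt_irrefl _ hω
      have h2 := (ENNReal.tendsto_sum_nat_add _ h1).ennrpow_const (t / 2)
      rwa [ENNReal.zero_rpow_of_pos (by positivity)] at h2
  have hcau : ∀ f, CauchySeq (u f) := by
    intro f
    refine cauchySeq_of_le_tendsto_0' (fun M => ((ENNReal.ofReal (C1 * K) * ε f M).toReal) ^ (s⁻¹)) ?_ ?_
    · intro M N hMN
      have hεt : ε f M ≠ ⊤ := by
        refine ne_top_of_le_ne_top (hJ f) (lintegral_mono fun ω => ?_)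
        exact ENNReal.rpow_le_rpow
          (ENNReal.tsum_comp_le_tsum_of_injective (add_left_injective M) _) (by positivity)
      have hmul : ENNReal.ofReal (C1 * K) * ε f M ≠ ⊤ := ENNReal.mul_ne_top (by simp) hεt
      rw [dist_comm, dist_eq_norm, Real.le_rpow_inv_iff_of_pos (norm_nonneg _) ENNReal.toReal_nonneg hs0,
        ← ENNReal.ofReal_le_iff_le_toReal hmul, hnorm]
      have h1 := (hpair (Finset.range N) (a f) (fun i ω => if i < M then a f i ω else 0) (ha f)
        (fun i => by split_ifs; exacts [ha f i, measurable_const])).2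
      refine le_trans (le_of_eq (lintegral_congr fun z => ?_)) (h1.trans
        (mul_le_mul_right (lintegral_mono fun ω => ENNReal.rpow_le_rpow ?_ (by positivity)) _))
      · have : ∑ i ∈ Finset.range N, (if i < M then a f i z.1 else 0) * z.2.1 i =
            ∑ i ∈ Finset.range M, a f i z.1 * z.2.1 i := by
          simp only [ite_mul, zero_mul]
          rw [← Finset.sum_filter]
          congr 1
          ext i; simp; omega
        simp only [this, W]
      · have : ∀ i, ENNReal.ofReal ((a f i ω - if i < M then a f i ω else 0) ^ 2) =
            if i < M then 0 else ENNReal.ofReal ((a f i ω) ^ 2) := by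
          intro i; split_ifs <;> simp
        simp only [this]
        obtain ⟨k, rfl⟩ := Nat.exists_eq_add_of_le hMN
        rw [Finset.sum_range_add, Finset.sum_eq_zero (s := Finset.range M), zero_add]
        · simp only [add_comm M]
          refine le_trans (le_of_eq ?_) (ENNReal.sum_le_tsum (Finset.range k))
          simp
        · intro i hi; simp [Finset.mem_range.1 hi]
    · have h1 : Tendsto (fun M => ENNReal.ofReal (C1 * K) * ε f M) atTop (𝓝 0) := by
        simpa using ENNReal.Tendsto.const_mul (hε f) (Or.inr ENNReal.ofReal_ne_top)
      have h2 := (ENNReal.tendsto_toReal ENNReal.zero_ne_top).comp h1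
      have h3 := h2.rpow_const (p := s⁻¹) (Or.inr (by positivity))
      simpa [Real.zero_rpow (inv_ne_zero hs0.ne')] using h3
  choose T0 hT0 using fun f => cauchySeq_tendsto_of_complete (hcau f)
  have hlim : ∀ f g, Tendsto (fun N => ENNReal.ofReal (‖u f N - u g N‖ ^ s)) atTop
      (𝓝 (ENNReal.ofReal (‖T0 f - T0 g‖ ^ s))) := fun f g =>
    ENNReal.tendsto_ofReal ((((hT0 f).sub (hT0 g)).norm).rpow_const (Or.inr hs0.le))
  have hlimI : ∀ f g, Tendsto (fun N => ∫⁻ ω, (∑ i ∈ Finset.range N,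
      ENNReal.ofReal ((a f i ω - a g i ω) ^ 2)) ^ (t / 2) ∂P) atTop (𝓝 (J (f - g))) := by
    intro f g
    have h1 : J (f - g) = ∫⁻ ω, (∑' i, ENNReal.ofReal ((a f i ω - a g i ω) ^ 2)) ^ (t / 2) ∂P := by
      refine lintegral_congr_ae ?_
      filter_upwards [ae_all_iff.2 (hsub f g)] with ω hω
      simp only [hω]
    rw [h1]
    refine lintegral_tendsto_of_tendsto_of_monotone ?_ (ae_of_all _ fun ω => ?_)
      (ae_of_all _ fun ω => ?_)
    · intro N
      refine (Measurable.pow_const (Finset.measurable_sum _ fun i _ => ?_) _).aemeasurable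
      have := ha f i; have := ha g i
      fun_prop
    · intro N M hNM
      exact ENNReal.rpow_le_rpow (Finset.sum_le_sum_of_subset (Finset.range_mono hNM)) (by positivity)
    · exact (ENNReal.tendsto_nat_tsum _).ennrpow_const _
  obtain ⟨φ, hφ⟩ := exists_transfer μ
  refine ⟨fun f => Lp.compMeasurePreserving φ hφ (T0 f), c1 * K * c, by positivity,
    C1 * K * C, by positivity, fun f g => ?_⟩
  rw [← map_sub, Lp.norm_compMeasurePreserving]
  have hp := fun N => hpair (Finset.range N) (a f) (a g) (ha f) (ha g)
  have e1 : ENNReal.ofReal (c1 * K) * J (f - g) ≤ ENNReal.ofReal (‖T0 f - T0 g‖ ^ s) :=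
    le_of_tendsto_of_tendsto' (ENNReal.Tendsto.const_mul (hlimI f g) (Or.inr ENNReal.ofReal_ne_top))
      (hlim f g) fun N => by rw [hnorm]; exact (hp N).1
  have e2 : ENNReal.ofReal (‖T0 f - T0 g‖ ^ s) ≤ ENNReal.ofReal (C1 * K) * J (f - g) :=
    le_of_tendsto_of_tendsto' (hlim f g)
      (ENNReal.Tendsto.const_mul (hlimI f g) (Or.inr ENNReal.ofReal_ne_top))
      fun N => by rw [hnorm]; exact (hp N).2
  constructor
  · rw [← ENNReal.ofReal_le_ofReal_iff (by positivity), mul_assoc, ENNReal.ofReal_mul (by positivity)]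
    exact (mul_le_mul_right (hb _).1 _).trans e1
  · rw [← ENNReal.ofReal_le_ofReal_iff (by positivity), mul_assoc, ENNReal.ofReal_mul (by positivity)]
    exact e2.trans (mul_le_mul_right (hb _).2 _)

lemma tele_A {δ : ℝ} (hδ : 0 < δ) {N : ℝ} (hN : 1 ≤ N) :
    δ * (N + 1) ^ (-(1 + δ)) ≤ N ^ (-δ) - (N + 1) ^ (-δ) := by
  have hn : 0 < N + 1 := by linarith
  have h1 : N ^ (-δ) = (N + 1) ^ (-δ) * (N / (N + 1)) ^ (-δ) := by
    rw [← Real.mul_rpow hn.le (by positivity)]; congr 1; field_simp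
  have h2 : 1 + δ * (N + 1)⁻¹ ≤ (N / (N + 1)) ^ (-δ) := by
    rw [Real.rpow_def_of_pos (by positivity)]
    have h3 := Real.add_one_le_exp (Real.log (N / (N + 1)) * -δ)
    have h4 := Real.log_le_sub_one_of_pos (show 0 < N / (N + 1) by positivity)
    have h5 : N / (N + 1) - 1 = - (N + 1)⁻¹ := by field_simp; ring
    rw [h5] at h4
    nlinarith
  have h6 : (N + 1) ^ (-(1 + δ)) = (N + 1) ^ (-δ) * (N + 1)⁻¹ := by
    rw [neg_add_rev, Real.rpow_add hn, Real.rpow_neg_one]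
  have h7 : 0 < (N + 1) ^ (-δ) := Real.rpow_pos_of_pos hn _
  rw [h1, h6]
  nlinarith

lemma sum_A_real {δ : ℝ} (hδ : 0 < δ) {z : ℝ} (hz : 0 < z) (N : ℕ) :
    ∑ i ∈ Finset.range N, (if z ≤ (i:ℝ) + 1 then (z / ((i:ℝ) + 1)) ^ (1 + δ) else 0) ≤
      if (N:ℝ) < z then 0 else z * (1 + δ⁻¹) - z ^ (1 + δ) * (N:ℝ) ^ (-δ) / δ := by
  induction N with
  | zero => simp [hz]
  | succ N ih =>
    rw [Finset.sum_range_succ]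
    push_cast
    have hn : (0:ℝ) < (N:ℝ) + 1 := by positivity
    by_cases h1 : (N:ℝ) + 1 < z
    · have h2 : (N:ℝ) < z := by linarith
      rw [if_pos h2] at ih
      rw [if_pos h1, if_neg (not_le.2 h1)]
      linarith
    rw [if_neg h1, if_pos (not_lt.1 h1)]
    push Not at h1
    by_cases h2 : (N:ℝ) < z
    · rw [if_pos h2] at ih
      have hq : z / ((N:ℝ) + 1) ≤ 1 := (div_le_one hn).2 h1
      have hq0 : 0 < z / ((N:ℝ) + 1) := by positivity
      have h3 : (z / ((N:ℝ) + 1)) ^ (1 + δ) ≤ z := by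
        calc _ ≤ (z / ((N:ℝ) + 1)) ^ (1:ℝ) :=
              Real.rpow_le_rpow_of_exponent_ge hq0 hq (by linarith)
          _ ≤ z := by
              rw [Real.rpow_one]
              exact div_le_self hz.le (by linarith [Nat.cast_nonneg (α := ℝ) N])
      have h4 : z ^ (1 + δ) * ((N:ℝ) + 1) ^ (-δ) ≤ z := by
        have : z ^ (1 + δ) * ((N:ℝ) + 1) ^ (-δ) = z * (z / ((N:ℝ) + 1)) ^ δ := by
          rw [Real.rpow_add hz, Real.rpow_one, Real.rpow_neg hn.le,
            Real.div_rpow hz.le hn.le]; ring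
        rw [this]
        have : (z / ((N:ℝ) + 1)) ^ δ ≤ 1 := Real.rpow_le_one hq0.le hq hδ.le
        nlinarith
      have h5 : z ^ (1 + δ) * ((N:ℝ) + 1) ^ (-δ) / δ ≤ z * δ⁻¹ := by
        rw [div_eq_mul_inv]; gcongr
      nlinarith
    · rw [if_neg h2] at ih
      push Not at h2
      have hN1 : (1:ℝ) ≤ N := by
        have : 0 < N := by
          rcases Nat.eq_zero_or_pos N with rfl | h
          · simp at h2; linarith
          · exact h
        exact_mod_cast this
      have h3 := tele_A hδ hN1
      have h4 : (z / ((N:ℝ) + 1)) ^ (1 + δ) = z ^ (1 + δ) * ((N:ℝ) + 1) ^ (-(1 + δ)) := by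
        rw [Real.div_rpow hz.le hn.le, Real.rpow_neg hn.le]; rfl
      have h5 : ((N:ℝ) + 1) ^ (-(1 + δ)) ≤ ((N:ℝ) ^ (-δ) - ((N:ℝ) + 1) ^ (-δ)) / δ := by
        rw [le_div_iff₀ hδ]; linarith
      have h6 : z ^ (1 + δ) * ((N:ℝ) + 1) ^ (-(1 + δ)) ≤
          z ^ (1 + δ) * (((N:ℝ) ^ (-δ) - ((N:ℝ) + 1) ^ (-δ)) / δ) := by gcongr
      rw [h4]
      have h7 : z ^ (1 + δ) * (((N:ℝ) ^ (-δ) - ((N:ℝ) + 1) ^ (-δ)) / δ) =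
        z ^ (1 + δ) * (N:ℝ) ^ (-δ) / δ - z ^ (1 + δ) * ((N:ℝ) + 1) ^ (-δ) / δ := by ring
      linarith

lemma sum_B_real {β : ℝ} (hβ0 : 0 < β) (hβ : β < 1) {z : ℝ} (hz : 0 < z) (N : ℕ) :
    ∑ i ∈ Finset.range N, (if (i:ℝ) + 1 < z then (z / ((i:ℝ) + 1)) ^ β else 0) ≤
      z ^ β * (min (N:ℝ) z) ^ (1 - β) / (1 - β) := by
  have hb : 0 < 1 - β := by linarith
  induction N with
  | zero => simp [hz.le, Real.zero_rpow hb.ne']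
  | succ N ih =>
    rw [Finset.sum_range_succ]
    push_cast
    have hn : (0:ℝ) < (N:ℝ) + 1 := by positivity
    by_cases h1 : (N:ℝ) + 1 < z
    · rw [if_pos h1]
      rw [min_eq_left (by linarith)] at ih ⊢
      have h3 : (N:ℝ) ^ (1 - β) = ((N:ℝ) + 1) ^ (1 - β) * (1 + -((N:ℝ) + 1)⁻¹) ^ (1 - β) := by
        have : 1 + -((N:ℝ) + 1)⁻¹ = N / ((N:ℝ) + 1) := by field_simp; ring
        rw [this, ← Real.mul_rpow hn.le (by positivity)]; congr 1; field_simp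
      have h4 := rpow_one_add_le_one_add_mul_self (s := -((N:ℝ) + 1)⁻¹)
        (by rw [neg_le_neg_iff]; exact inv_le_one_of_one_le₀ (by linarith [Nat.cast_nonneg (α := ℝ) N]))
        hb.le (by linarith)
      have h5 : (z / ((N:ℝ) + 1)) ^ β = z ^ β * (((N:ℝ) + 1) ^ (1 - β) * ((N:ℝ) + 1)⁻¹) := by
        rw [Real.div_rpow hz.le hn.le, ← Real.rpow_neg_one ((N:ℝ) + 1), ← Real.rpow_add hn,
          show 1 - β + -1 = -β by ring, Real.rpow_neg hn.le]; rfl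
      have h6 : (N:ℝ) ^ (1 - β) + (1 - β) * (((N:ℝ) + 1) ^ (1 - β) * ((N:ℝ) + 1)⁻¹) ≤
          ((N:ℝ) + 1) ^ (1 - β) := by
        rw [h3]
        have : 0 < ((N:ℝ) + 1) ^ (1 - β) := by positivity
        nlinarith
      have h7 : z ^ β * ((N:ℝ) ^ (1 - β) + (1 - β) * (((N:ℝ) + 1) ^ (1 - β) * ((N:ℝ) + 1)⁻¹)) / (1 - β) ≤
          z ^ β * ((N:ℝ) + 1) ^ (1 - β) / (1 - β) := by gcongr
      have h8 : z ^ β * ((N:ℝ) ^ (1 - β) + (1 - β) * (((N:ℝ) + 1) ^ (1 - β) * ((N:ℝ) + 1)⁻¹)) / (1 - β)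
        = z ^ β * (N:ℝ) ^ (1 - β) / (1 - β) + z ^ β * (((N:ℝ) + 1) ^ (1 - β) * ((N:ℝ) + 1)⁻¹) := by
        field_simp
      rw [h5]; linarith
    · rw [if_neg h1, add_zero]
      refine ih.trans ?_
      gcongr
      linarith

lemma sum_A {α : ℝ} (hα : 1 < α) (z : ℝ≥0∞) :
    ∑' i : ℕ, (if z ≤ (i:ℝ≥0∞) + 1 then (z / ((i:ℝ≥0∞) + 1)) ^ α else 0) ≤
      ENNReal.ofReal (1 + (α - 1)⁻¹) * z := by
  have hδ : 0 < α - 1 := by linarith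
  have hpos : 0 < 1 + (α - 1)⁻¹ := by positivity
  rcases eq_or_ne z ⊤ with rfl | hzt
  · rw [ENNReal.mul_top (by simpa using hpos)]; exact le_top
  rcases eq_or_ne z 0 with rfl | hz0
  · simp [ENNReal.zero_rpow_of_pos (show 0 < α by linarith)]
  lift z to ℝ≥0 using hzt
  have hz : 0 < (z:ℝ) := by
    have : z ≠ 0 := by simpa using hz0
    exact_mod_cast pos_iff_ne_zero.2 this
  refine ENNReal.tsum_le_of_sum_range_le fun N => ?_
  have h1 := sum_A_real hδ hz N
  have h2 : (if (N:ℝ) < z then 0 else (z:ℝ) * (1 + (α - 1)⁻¹) -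
      (z:ℝ) ^ (1 + (α - 1)) * (N:ℝ) ^ (-(α - 1)) / (α - 1)) ≤ (1 + (α - 1)⁻¹) * z := by
    split_ifs
    · positivity
    · have : 0 ≤ (z:ℝ) ^ (1 + (α - 1)) * (N:ℝ) ^ (-(α - 1)) / (α - 1) := by positivity
      linarith
  have h3 := ENNReal.ofReal_le_ofReal (h1.trans h2)
  rw [ENNReal.ofReal_mul hpos.le, ENNReal.ofReal_coe_nnreal, ENNReal.ofReal_sum_of_nonneg] at h3
  · refine le_trans (le_of_eq (Finset.sum_congr rfl fun i _ => ?_)) h3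
    have hc : ((i:ℝ≥0∞) + 1) = (((i:ℝ≥0) + 1 : ℝ≥0) : ℝ≥0∞) := by push_cast; rfl
    have hc' : (z ≤ (i:ℝ≥0) + 1) ↔ ((z:ℝ) ≤ (i:ℝ) + 1) := by
      rw [← NNReal.coe_le_coe]; push_cast; rfl
    rw [hc]
    simp only [ENNReal.coe_le_coe, hc']
    split_ifs
    · rw [← ENNReal.coe_div (by positivity), ← ENNReal.coe_rpow_of_nonneg _ (by linarith),
        ← ENNReal.ofReal_coe_nnreal]
      push_cast
      congr 2; ring
    · simp
  · intro i _; split_ifs <;> positivity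

lemma sum_B {β : ℝ} (hβ0 : 0 < β) (hβ : β < 1) (z : ℝ≥0∞) :
    ∑' i : ℕ, (if z ≤ (i:ℝ≥0∞) + 1 then 0 else (z / ((i:ℝ≥0∞) + 1)) ^ β) ≤
      ENNReal.ofReal ((1 - β)⁻¹) * z := by
  have hδ : 0 < 1 - β := by linarith
  have hpos : 0 < (1 - β)⁻¹ := by positivity
  rcases eq_or_ne z ⊤ with rfl | hzt
  · rw [ENNReal.mul_top (by simpa using hβ)]; exact le_top
  rcases eq_or_ne z 0 with rfl | hz0
  · simp
  lift z to ℝ≥0 using hzt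
  have hz : 0 < (z:ℝ) := by
    have : z ≠ 0 := by simpa using hz0
    exact_mod_cast pos_iff_ne_zero.2 this
  refine ENNReal.tsum_le_of_sum_range_le fun N => ?_
  have h1 := sum_B_real hβ0 hβ hz N
  have h2 : (z:ℝ) ^ β * (min (N:ℝ) z) ^ (1 - β) / (1 - β) ≤ (1 - β)⁻¹ * z := by
    calc _ ≤ (z:ℝ) ^ β * (z:ℝ) ^ (1 - β) / (1 - β) := by
          gcongr
          exact min_le_right _ _
      _ = _ := by
          rw [← Real.rpow_add hz, show β + (1 - β) = 1 by ring, Real.rpow_one]; ring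
  have h3 := ENNReal.ofReal_le_ofReal (h1.trans h2)
  rw [ENNReal.ofReal_mul hpos.le, ENNReal.ofReal_coe_nnreal, ENNReal.ofReal_sum_of_nonneg] at h3
  · refine le_trans (le_of_eq (Finset.sum_congr rfl fun i _ => ?_)) h3
    have hc : ((i:ℝ≥0∞) + 1) = (((i:ℝ≥0) + 1 : ℝ≥0) : ℝ≥0∞) := by push_cast; rfl
    have hc' : (z ≤ (i:ℝ≥0) + 1) ↔ ¬ ((i:ℝ) + 1 < (z:ℝ)) := by
      rw [← NNReal.coe_le_coe, not_lt]; push_cast; rfl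
    rw [hc]
    simp only [ENNReal.coe_le_coe, hc']
    split_ifs
    · rw [← ENNReal.coe_div (by positivity), ← ENNReal.coe_rpow_of_nonneg _ (by linarith),
        ← ENNReal.ofReal_coe_nnreal]
      push_cast
      rfl
    · simp
  · intro i _; split_ifs <;> positivity

lemma rpow_tsum_le {τ : ℝ} (h0 : 0 < τ) (h1 : τ ≤ 1) (x : ℕ → ℝ≥0∞) :
    (∑' i, x i) ^ τ ≤ ∑' i, x i ^ τ := by
  refine le_of_tendsto' ((ENNReal.tendsto_nat_tsum x).ennrpow_const τ) fun N => ?_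
  refine le_trans ?_ (ENNReal.sum_le_tsum (Finset.range N))
  induction N with
  | zero => simp [h0]
  | succ N ih =>
    rw [Finset.sum_range_succ, Finset.sum_range_succ]
    exact (ENNReal.rpow_add_le_add_rpow _ _ h0.le h1).trans (by gcongr)

lemma core_upper {E : Type*} [MeasurableSpace E] (lam : Measure E) [IsProbabilityMeasure lam]
    {α τ : ℝ} (hα : 1 < α) (hτ : 0 < τ) (hτ1 : τ ≤ 1) (hατ : α * τ < 1) (Z : E → ℝ≥0∞)
    (hZ : Measurable Z) (hZ1 : ∫⁻ x, Z x ∂lam = 1) :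
    ∫⁻ ω, (∑' i : ℕ, (Z (ω i) / ((i:ℝ≥0∞) + 1)) ^ α) ^ τ ∂(Measure.infinitePi fun _ : ℕ => lam) ≤
      ENNReal.ofReal (1 + (1 + (α - 1)⁻¹) + (1 - α * τ)⁻¹) := by
  set P := Measure.infinitePi fun _ : ℕ => lam
  have hα0 : 0 < α := by linarith
  let A : ℕ → ℝ≥0∞ → ℝ≥0∞ := fun i z =>
    if z ≤ (i:ℝ≥0∞) + 1 then (z / ((i:ℝ≥0∞) + 1)) ^ α else 0
  let B : ℕ → ℝ≥0∞ → ℝ≥0∞ := fun i z =>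
    if z ≤ (i:ℝ≥0∞) + 1 then 0 else (z / ((i:ℝ≥0∞) + 1)) ^ (α * τ)
  have hAm : ∀ i, Measurable (A i) := fun i =>
    Measurable.ite measurableSet_Iic (by fun_prop) measurable_const
  have hBm : ∀ i, Measurable (B i) := fun i =>
    Measurable.ite measurableSet_Iic measurable_const (by fun_prop)
  have hpt : ∀ ω : ℕ → E, (∑' i : ℕ, (Z (ω i) / ((i:ℝ≥0∞) + 1)) ^ α) ^ τ ≤
      1 + ∑' i, A i (Z (ω i)) + ∑' i, B i (Z (ω i)) := by
    intro ω
    have h1 : ∀ i : ℕ, (Z (ω i) / ((i:ℝ≥0∞) + 1)) ^ α = A i (Z (ω i)) +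
        (if Z (ω i) ≤ (i:ℝ≥0∞) + 1 then 0 else (Z (ω i) / ((i:ℝ≥0∞) + 1)) ^ α) := by
      intro i; simp only [A]; split_ifs <;> simp
    rw [tsum_congr h1, ENNReal.tsum_add]
    refine (ENNReal.rpow_add_le_add_rpow _ _ hτ.le hτ1).trans (add_le_add ?_ ?_)
    · generalize ∑' i, A i (Z (ω i)) = y
      rcases le_total y 1 with h | h
      · exact (ENNReal.rpow_le_one h hτ.le).trans le_self_add
      · refine le_trans ?_ le_add_self
        calc y ^ τ ≤ y ^ (1:ℝ) := ENNReal.rpow_le_rpow_of_exponent_le h hτ1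
          _ = y := ENNReal.rpow_one _
    · refine (rpow_tsum_le hτ hτ1 _).trans (ENNReal.tsum_le_tsum fun i => ?_)
      simp only [B]
      split_ifs
      · simp [hτ]
      · rw [ENNReal.rpow_mul]
  have hev : ∀ (G : ℝ≥0∞ → ℝ≥0∞) (i : ℕ), Measurable G →
      ∫⁻ ω, G (Z (ω i)) ∂P = ∫⁻ x, G (Z x) ∂lam := by
    intro G i hG
    exact (measurePreserving_eval_infinitePi (fun _ : ℕ => lam) i).lintegral_comp (hG.comp hZ)
  have hint : ∀ (A : ℕ → ℝ≥0∞ → ℝ≥0∞) (k : ℝ), (∀ i, Measurable (A i)) →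
      (∀ z, ∑' i, A i z ≤ ENNReal.ofReal k * z) →
      ∫⁻ ω, ∑' i, A i (Z (ω i)) ∂P ≤ ENNReal.ofReal k := by
    intro A k hA hk
    have e1 : ∫⁻ ω, ∑' i, A i (Z (ω i)) ∂P = ∑' i, ∫⁻ ω, A i (Z (ω i)) ∂P :=
      lintegral_tsum fun i => ((hA i).comp (hZ.comp (measurable_pi_apply i))).aemeasurable
    have e2 : ∫⁻ x, ∑' i, A i (Z x) ∂lam = ∑' i, ∫⁻ x, A i (Z x) ∂lam :=
      lintegral_tsum fun i => ((hA i).comp hZ).aemeasurable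
    rw [e1, tsum_congr fun i => hev (A i) i (hA i), ← e2]
    calc _ ≤ ∫⁻ x, ENNReal.ofReal k * Z x ∂lam := lintegral_mono fun x => hk _
      _ = _ := by rw [lintegral_const_mul _ hZ, hZ1, mul_one]
  have hmA : Measurable fun ω : ℕ → E => ∑' i, A i (Z (ω i)) :=
    Measurable.tsum fun i => (hAm i).comp (hZ.comp (measurable_pi_apply i))
  have hδ : 0 < (α - 1)⁻¹ := inv_pos.2 (by linarith)
  have hδ' : 0 < (1 - α * τ)⁻¹ := inv_pos.2 (by linarith)
  calc _ ≤ ∫⁻ ω, (1 + ∑' i, A i (Z (ω i))) + ∑' i, B i (Z (ω i)) ∂P := lintegral_mono hpt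
    _ = 1 + ∫⁻ ω, ∑' i, A i (Z (ω i)) ∂P + ∫⁻ ω, ∑' i, B i (Z (ω i)) ∂P := by
        have hm1 : Measurable fun ω : ℕ → E => 1 + ∑' i, A i (Z (ω i)) := measurable_const.add hmA
        rw [lintegral_add_left hm1, lintegral_add_left measurable_const]
        simp
    _ ≤ 1 + ENNReal.ofReal (1 + (α - 1)⁻¹) + ENNReal.ofReal ((1 - α * τ)⁻¹) := by
        gcongr
        · exact hint A _ hAm (sum_A hα)
        · exact hint B _ hBm (sum_B (by positivity) hατ)
    _ = _ := by
        rw [ENNReal.ofReal_add (by positivity) hδ'.le, ENNReal.ofReal_add (p := 1) (q := 1 + (α - 1)⁻¹) one_pos.le (by positivity),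
          ENNReal.ofReal_one]

lemma core_lower {E : Type*} [MeasurableSpace E] (lam : Measure E) [IsProbabilityMeasure lam]
    {α τ : ℝ} (hα : 1 < α) (hτ : 0 < τ) (Z : E → ℝ≥0∞)
    (hZ : Measurable Z) (hZ1 : ∫⁻ x, Z x ∂lam = 1) :
    ENNReal.ofReal ((1 / 2) ^ (α * τ) * (1 / 3)) ≤
    ∫⁻ ω, (∑' i : ℕ, (Z (ω i) / ((i:ℝ≥0∞) + 1)) ^ α) ^ τ ∂(Measure.infinitePi fun _ : ℕ => lam) := by
  set P := Measure.infinitePi fun _ : ℕ => lam with hP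
  have hα0 : 0 < α := by linarith
  let V : ℕ → Set E := fun i => {x | ((i:ℝ≥0∞) + 1) / 2 ≤ Z x}
  have hV : ∀ i, MeasurableSet (V i) := fun i => measurableSet_le measurable_const hZ
  -- sum of probabilities
  have hcount : ∀ z : ℝ≥0∞, 2 * z ≤ 1 + ∑' i : ℕ, (if ((i:ℝ≥0∞) + 1) / 2 ≤ z then 1 else 0) := by
    intro z
    have hge : ∀ n : ℕ, (n:ℝ≥0∞) ≤ 2 * z →
        (n:ℝ≥0∞) ≤ ∑' i : ℕ, (if ((i:ℝ≥0∞) + 1) / 2 ≤ z then (1:ℝ≥0∞) else 0) := by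
      intro n hn
      refine le_trans ?_ (ENNReal.sum_le_tsum (Finset.range n))
      rw [Finset.sum_congr rfl (g := fun _ => (1:ℝ≥0∞))]
      · simp
      · intro i hi
        rw [if_pos]
        rw [ENNReal.div_le_iff' (by simp) (by simp)]
        refine le_trans ?_ hn
        have := Finset.mem_range.1 hi
        exact_mod_cast this
    rcases eq_or_ne z ⊤ with rfl | hz
    · simp [ENNReal.tsum_const_eq_top_of_ne_zero]
    · lift z to ℝ≥0 using hz
      have h1 : ((2 * z : ℝ≥0) : ℝ≥0∞) ≤ 1 + (⌊2 * z⌋₊ : ℝ≥0∞) := by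
        have := (Nat.lt_floor_add_one (2 * z)).le
        rw [add_comm]
        exact_mod_cast this
      push_cast at h1
      refine h1.trans (add_le_add_right (hge _ ?_) _)
      have := Nat.floor_le (show 0 ≤ 2 * z from zero_le)
      exact_mod_cast this
  have hsum : 1 ≤ ∑' i, lam (V i) := by
    have h1 : ∫⁻ x, 2 * Z x ∂lam ≤ ∫⁻ x, 1 + ∑' i : ℕ, (V i).indicator 1 x ∂lam := by
      refine lintegral_mono fun x => (hcount (Z x)).trans (le_of_eq ?_)
      congr 1
      refine tsum_congr fun i => ?_
      by_cases h : ((i:ℝ≥0∞) + 1) / 2 ≤ Z x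
      · rw [if_pos h, Set.indicator_of_mem (show x ∈ V i from h)]; rfl
      · rw [if_neg h, Set.indicator_of_notMem (show x ∉ V i from h)]
    rw [lintegral_const_mul _ hZ, hZ1, lintegral_add_left measurable_const,
      lintegral_tsum fun i => (measurable_one.indicator (hV i)).aemeasurable] at h1
    simp only [lintegral_indicator_one (hV _), lintegral_const, measure_univ, mul_one] at h1
    rw [← one_add_one_eq_two] at h1
    exact (ENNReal.add_le_add_iff_left (by simp)).1 h1
  obtain ⟨N, hN⟩ : ∃ N, (1/2 : ℝ≥0∞) < ∑ i ∈ Finset.range N, lam (V i) := by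
    have h2 : (1/2 : ℝ≥0∞) < ∑' i, lam (V i) := lt_of_lt_of_le (by
      rw [ENNReal.div_lt_iff] <;> norm_num) hsum
    exact ((ENNReal.tendsto_nat_tsum _).eventually (lt_mem_nhds h2)).exists
  let G : Set (ℕ → E) := Set.pi (Finset.range N) fun i => (V i)ᶜ
  have hG : MeasurableSet G := MeasurableSet.pi (Finset.countable_toSet _) fun i _ => (hV i).compl
  have hPG : P G ≤ ENNReal.ofReal (2 / 3) := by
    rw [hP, Measure.infinitePi_pi _ fun i _ => (hV i).compl]
    let p : ℕ → ℝ := fun i => lam.real (V i)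
    have hp : ∀ i, lam (V i)ᶜ = ENNReal.ofReal (1 - p i) := by
      intro i
      rw [← probReal_compl_eq_one_sub (hV i), ofReal_measureReal]
    have hp1 : ∀ i, p i ≤ 1 := fun i => measureReal_le_one
    simp only [hp]
    rw [← ENNReal.ofReal_prod_of_nonneg fun i _ => by linarith [hp1 i]]
    refine ENNReal.ofReal_le_ofReal ?_
    have hs : 1 / 2 ≤ ∑ i ∈ Finset.range N, p i := by
      have h3 := ENNReal.toReal_mono (by simp) hN.le
      rw [ENNReal.toReal_sum (by simp)] at h3
      simpa [p, Measure.real] using h3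
    calc _ ≤ ∏ i ∈ Finset.range N, Real.exp (-p i) :=
          Finset.prod_le_prod (fun i _ => by linarith [hp1 i]) fun i _ => Real.one_sub_le_exp_neg _
      _ = Real.exp (-∑ i ∈ Finset.range N, p i) := by
          rw [← Real.exp_sum, Finset.sum_neg_distrib]
      _ ≤ Real.exp (-(1 / 2)) := Real.exp_le_exp.2 (by linarith)
      _ ≤ 2 / 3 := by
          rw [Real.exp_neg, inv_le_comm₀ (Real.exp_pos _) (by norm_num)]
          have := Real.add_one_le_exp (1 / 2 : ℝ)
          linarith
  have hPGc : ENNReal.ofReal (1 / 3) ≤ P Gᶜ := by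
    rw [prob_compl_eq_one_sub hG]
    refine ENNReal.le_sub_of_add_le_right (by simp) ?_
    refine (add_le_add_right hPG _).trans ?_
    rw [← ENNReal.ofReal_add (by norm_num) (by norm_num)]
    norm_num
  rw [ENNReal.ofReal_mul (by positivity)]
  calc _ ≤ ENNReal.ofReal ((1 / 2) ^ (α * τ)) * P Gᶜ := by gcongr
    _ = ∫⁻ ω in Gᶜ, ENNReal.ofReal ((1 / 2) ^ (α * τ)) ∂P := by simp
    _ ≤ ∫⁻ ω in Gᶜ, (∑' i : ℕ, (Z (ω i) / ((i:ℝ≥0∞) + 1)) ^ α) ^ τ ∂P := by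
        refine setLIntegral_mono' hG.compl fun ω hω => ?_
        have : ∃ i, ω i ∈ V i := by
          by_contra hcon
          push Not at hcon
          exact hω fun i _ => hcon i
        obtain ⟨i, hi⟩ := this
        rw [← ENNReal.ofReal_rpow_of_nonneg (by norm_num) (by positivity), ENNReal.rpow_mul]
        refine ENNReal.rpow_le_rpow (le_trans (ENNReal.rpow_le_rpow ?_ hα0.le)
          (ENNReal.le_tsum i)) hτ.le
        rw [ENNReal.le_div_iff_mul_le (by simp) (by simp)]
        refine le_trans (le_of_eq ?_) hi
        rw [mul_comm, div_eq_mul_inv]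
        congr 1
        rw [one_mul, ENNReal.ofReal_inv_of_pos (by norm_num)]; simp
    _ ≤ _ := setLIntegral_le_lintegral _ _

instance prob_I : IsProbabilityMeasure ((volume : Measure ℝ).restrict (Set.Icc 0 1)) := ⟨by simp⟩

def ConclT (r s t : ℝ) : Prop :=
  ∃ T : LSp r → LSp s, ∃ c > 0, ∃ C > 0, ∀ f g,
      c * ‖f - g‖ ^ t ≤ ‖T f - T g‖ ^ s ∧ ‖T f - T g‖ ^ s ≤ C * ‖f - g‖ ^ t

lemma case_eq {r s : ℝ} (hr : 1 ≤ r) (hs : 1 ≤ s) (hts : r ≤ s)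
    [Fact (1 ≤ ENNReal.ofReal r)] [Fact (1 ≤ ENNReal.ofReal s)] : ConclT r s r := by
  have hr0 : 0 < r := by linarith
  refine assembly (X := LSp r) ((volume : Measure ℝ).restrict (Set.Icc 0 1)) hr0 hts hs
    (fun f i ω => if i = 0 then f ω else 0) ?_ ?_ one_pos one_pos fun f => ?_
  · intro f i
    split_ifs
    · exact (Lp.stronglyMeasurable f).measurable
    · exact measurable_const
  · intro f g i
    filter_upwards [Lp.coeFn_sub f g] with ω hω
    split_ifs
    · rw [hω]; rfl
    · simp
  · have : ∫⁻ ω in Set.Icc (0:ℝ) 1, (∑' i : ℕ, ENNReal.ofReal ((if i = 0 then f ω else 0) ^ 2)) ^ (r / 2) =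
        ENNReal.ofReal (1 * ‖f‖ ^ r) := by
      rw [one_mul, LSp_norm_rpow hr]
      refine lintegral_congr fun ω => ?_
      rw [tsum_eq_single 0 (by intro i hi; simp [hi]), if_pos rfl,
        ENNReal.ofReal_rpow_of_nonneg (sq_nonneg _) (by positivity), ← sq_abs,
        ← Real.rpow_natCast, ← Real.rpow_mul (abs_nonneg _)]
      congr 2; push_cast; ring
    exact ⟨this.ge, this.le⟩

lemma exists_coord {p : ℝ≥0∞} (hp : p = 2) [Fact (1 ≤ p)] :
    ∃ b : Lp ℝ p ((volume : Measure ℝ).restrict (Set.Icc 0 1)) → ℕ → ℝ,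
      (∀ f g i, b f i - b g i = b (f - g) i) ∧
      ∀ f, ∑' i, ENNReal.ofReal ((b f i) ^ 2) = ENNReal.ofReal (‖f‖ ^ 2) := by
  subst hp
  obtain ⟨w, e, -⟩ := exists_hilbertBasis ℝ (Lp ℝ 2 ((volume : Measure ℝ).restrict (Set.Icc 0 1)))
  have : Fact ((2:ℝ≥0∞) ≠ ⊤) := ⟨by simp⟩
  have hw : Countable w := by
    have hd : ∀ i j, i ≠ j → 1 ≤ dist (e i) (e j) := by
      intro i j hij
      have h1 : ‖e i - e j‖ ^ 2 = 2 := by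
        rw [@norm_sub_sq_real, e.orthonormal.1, e.orthonormal.1, e.orthonormal.2 hij]; norm_num
      rw [dist_eq_norm]
      nlinarith [norm_nonneg (e i - e j)]
    refine Pairwise.countable_of_isOpen_disjoint (s := fun i => Metric.ball (e i) (1 / 2)) ?_
      (fun i => Metric.isOpen_ball) (fun i => ⟨e i, by simp⟩)
    intro i j hij
    exact Metric.ball_disjoint_ball (by have := hd i j hij; linarith)
  have := Encodable.ofCountable w
  refine ⟨fun f n => match Encodable.decode₂ w n with
    | some j => inner ℝ f (e j)
    | none => 0, ?_, ?_⟩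
  · intro f g i
    rcases h : Encodable.decode₂ w i with _ | j
    · simp [h]
    · simp [h, inner_sub_left]
  · intro f
    have h1 := e.hasSum_inner_mul_inner f f
    rw [real_inner_self_eq_norm_sq] at h1
    have h2 : (fun i => inner ℝ f (e i) * inner ℝ (e i) f) = fun i => (inner ℝ f (e i)) ^ 2 := by
      funext i; rw [real_inner_comm f (e i)]; ring
    rw [h2] at h1
    rw [← h1.tsum_eq, ENNReal.ofReal_tsum_of_nonneg (fun _ => sq_nonneg _) h1.summable,
      ← (Encodable.encode_injective (α := w)).tsum_eq]
    · refine tsum_congr fun j => ?_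
      simp
    · intro n hn
      simp only [Function.mem_support] at hn
      rcases h : Encodable.decode₂ w n with _ | j
      · simp [h] at hn
      · exact ⟨j, Encodable.mem_decode₂.1 h⟩

lemma case_two {s t : ℝ} (ht : 0 < t) (hts : t ≤ s) (hs : 1 ≤ s)
    [Fact (1 ≤ ENNReal.ofReal 2)] [Fact (1 ≤ ENNReal.ofReal s)] : ConclT 2 s t := by
  obtain ⟨b, hb1, hb2⟩ := exists_coord (p := ENNReal.ofReal 2) (by simp)
  refine assembly (X := LSp 2) (Measure.dirac ()) ht hts hs
    (fun f i ω => b f i) (fun _ _ => measurable_const)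
    (fun f g i => ae_of_all _ fun _ => hb1 f g i) one_pos one_pos fun f => ?_
  have : ∫⁻ ω : Unit, (∑' i : ℕ, ENNReal.ofReal (b f i ^ 2)) ^ (t / 2) ∂(Measure.dirac ()) =
        ENNReal.ofReal (1 * ‖f‖ ^ t) := by
    rw [lintegral_const, measure_univ, mul_one, hb2,
      ENNReal.ofReal_rpow_of_nonneg (sq_nonneg _) (by positivity), ← Real.rpow_natCast,
      ← Real.rpow_mul (norm_nonneg _), one_mul]
    congr 2; push_cast; ring
  exact ⟨this.ge, this.le⟩

lemma case_lt {r s t : ℝ} (hr : 1 ≤ r) (hr2 : r < 2) (ht : 0 < t) (htr : t < r) (hts : t ≤ s)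
    (hs : 1 ≤ s) [Fact (1 ≤ ENNReal.ofReal r)] [Fact (1 ≤ ENNReal.ofReal s)] : ConclT r s t := by
  have hr0 : 0 < r := by linarith
  set lam := (volume : Measure ℝ).restrict (Set.Icc 0 1) with hlam
  have hα : 1 < 2 / r := by rw [lt_div_iff₀ hr0]; linarith
  have hτ : 0 < t / 2 := by positivity
  have hατ' : 2 / r * (t / 2) = t / r := by field_simp
  have hατ : 2 / r * (t / 2) < 1 := by rw [hατ', div_lt_one hr0]; exact htr
  have hC : 0 < 1 + (1 + (2 / r - 1)⁻¹) + (1 - 2 / r * (t / 2))⁻¹ := by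
    have h1 : 0 < (2 / r - 1)⁻¹ := inv_pos.2 (by linarith)
    have h2 : 0 < (1 - 2 / r * (t / 2))⁻¹ := inv_pos.2 (by linarith)
    positivity
  have hmp := fun i : ℕ => measurePreserving_eval_infinitePi (fun _ : ℕ => lam) i
  refine assembly (X := LSp r) (Measure.infinitePi fun _ : ℕ => lam) ht hts hs
    (fun f i ω => ((i:ℝ) + 1) ^ (-(1 / r)) * f (ω i)) ?_ ?_
    (c := (1 / 2) ^ (2 / r * (t / 2)) * (1 / 3)) (by positivity) hC fun f => ?_
  · intro f i
    exact measurable_const.mul ((Lp.stronglyMeasurable f).measurable.comp (measurable_pi_apply i))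
  · intro f g i
    filter_upwards [(hmp i).quasiMeasurePreserving.ae (Lp.coeFn_sub f g)] with ω hω
    simp only [Function.eval] at hω
    rw [hω, Pi.sub_apply]; ring
  rcases eq_or_ne f 0 with rfl | hf
  · have : ∫⁻ ω : ℕ → ℝ, (∑' i : ℕ, ENNReal.ofReal ((((i:ℝ) + 1) ^ (-(1 / r)) *
        (0 : LSp r) (ω i)) ^ 2)) ^ (t / 2) ∂(Measure.infinitePi fun _ : ℕ => lam) = 0 := by
      rw [← lintegral_zero (μ := Measure.infinitePi fun _ : ℕ => lam)]
      refine lintegral_congr_ae ?_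
      have h0 : ∀ i : ℕ, ∀ᵐ ω ∂(Measure.infinitePi fun _ : ℕ => lam), (0 : LSp r) (ω i) = 0 :=
        fun i => (hmp i).quasiMeasurePreserving.ae (Lp.coeFn_zero ℝ (ENNReal.ofReal r) lam)
      filter_upwards [ae_all_iff.2 h0] with ω hω
      simp [hω, hτ]
    rw [this]
    simp [Real.zero_rpow ht.ne']
  have hn : 0 < ‖f‖ := norm_pos_iff.2 hf
  have hfm : Measurable f := (Lp.stronglyMeasurable f).measurable
  let Z : ℝ → ℝ≥0∞ := fun x => ENNReal.ofReal (‖f‖ ^ r)⁻¹ * ENNReal.ofReal (|f x| ^ r)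
  have hZm : Measurable fun x => ENNReal.ofReal (|f x| ^ r) := by fun_prop
  have hZ : Measurable Z := hZm.const_mul _
  have hZ1 : ∫⁻ x, Z x ∂lam = 1 := by
    rw [lintegral_const_mul _ hZm, ← LSp_norm_rpow hr, ← ENNReal.ofReal_mul (by positivity),
      inv_mul_cancel₀ (by positivity), ENNReal.ofReal_one]
  have hupp := core_upper lam hα hτ (by linarith) hατ Z hZ hZ1
  have hlow := core_lower lam hα hτ Z hZ hZ1
  have hterm : ∀ (ω : ℕ → ℝ) (i : ℕ), ENNReal.ofReal ((((i:ℝ) + 1) ^ (-(1 / r)) * f (ω i)) ^ 2) =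
      ENNReal.ofReal (‖f‖ ^ 2) * (Z (ω i) / ((i:ℝ≥0∞) + 1)) ^ (2 / r) := by
    intro ω i
    have hi : (0:ℝ) < (i:ℝ) + 1 := by positivity
    have e1 : (i:ℝ≥0∞) + 1 = ENNReal.ofReal ((i:ℝ) + 1) := by
      rw [ENNReal.ofReal_add (by positivity) one_pos.le]; simp
    simp only [Z]
    rw [e1, ← ENNReal.ofReal_mul (by positivity), ← ENNReal.ofReal_div_of_pos hi,
      ENNReal.ofReal_rpow_of_nonneg (by positivity) (by positivity),
      ← ENNReal.ofReal_mul (by positivity)]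
    congr 1
    rw [Real.div_rpow (by positivity) hi.le, Real.mul_rpow (by positivity) (by positivity),
      Real.inv_rpow (by positivity), ← Real.rpow_mul hn.le, ← Real.rpow_mul (abs_nonneg _),
      show r * (2 / r) = (2:ℕ) by push_cast; field_simp, Real.rpow_natCast, Real.rpow_natCast, sq_abs,
      mul_pow, ← Real.rpow_natCast (((i:ℝ) + 1) ^ (-(1 / r))), ← Real.rpow_mul hi.le,
      show -(1 / r) * ((2:ℕ):ℝ) = -(2 / r) by push_cast; ring, Real.rpow_neg hi.le]
    field_simp
  have hint : ∫⁻ ω : ℕ → ℝ, (∑' i : ℕ, ENNReal.ofReal ((((i:ℝ) + 1) ^ (-(1 / r)) *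
        f (ω i)) ^ 2)) ^ (t / 2) ∂(Measure.infinitePi fun _ : ℕ => lam) =
      ENNReal.ofReal (‖f‖ ^ t) * ∫⁻ ω, (∑' i : ℕ, (Z (ω i) / ((i:ℝ≥0∞) + 1)) ^ (2 / r)) ^ (t / 2)
        ∂(Measure.infinitePi fun _ : ℕ => lam) := by
    rw [← lintegral_const_mul']
    · refine lintegral_congr fun ω => ?_
      rw [tsum_congr (hterm ω), ENNReal.tsum_mul_left, ENNReal.mul_rpow_of_nonneg _ _ hτ.le,
        ENNReal.ofReal_rpow_of_nonneg (by positivity) hτ.le, ← Real.rpow_natCast,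
        ← Real.rpow_mul hn.le]
      congr 4; push_cast; ring
    · exact ENNReal.ofReal_ne_top
  rw [hint]
  constructor
  · rw [mul_comm (_ * _) (‖f‖ ^ t), ENNReal.ofReal_mul (by positivity)]
    gcongr
  · rw [mul_comm _ (‖f‖ ^ t), ENNReal.ofReal_mul (by positivity)]
    gcongr

lemma exists_T {r s t : ℝ} (hr : 1 ≤ r) (hr2 : r ≤ 2) (ht : 0 < t) (htr : t ≤ r) (hts : t ≤ s)
    (hs : 1 ≤ s) [Fact (1 ≤ ENNReal.ofReal r)] [Fact (1 ≤ ENNReal.ofReal s)] : ConclT r s t := by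
  rcases htr.eq_or_lt with rfl | htr
  · exact case_eq hr hs hts
  rcases hr2.eq_or_lt with rfl | hr2
  · exact case_two ht hts hs
  · exact case_lt hr hr2 ht htr hts hs

lemma suff {r s p q : ℝ} (hr : 1 ≤ r) (hr2 : r ≤ 2)
    (hs : 1 ≤ s) (hp : 1 ≤ p) (hq : 1 ≤ q) 
    [Fact (1 ≤ ENNReal.ofReal r)] [Fact (1 ≤ ENNReal.ofReal s)] (hpq : p ≤ q) (hrs : s/q ≤ r/p) :
    BorelReducible (ESum (LSp r) p) (ESum (LSp s) q) := by
  have hs0 : 0 < s := by linarith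
  have hp0 : 0 < p := by linarith
  have hq0 : 0 < q := by linarith
  have ht : 0 < p * s / q := by positivity
  have htr : p * s / q ≤ r := by
    rw [le_div_iff₀ hp0] at hrs
    calc _ = s / q * p := by ring
      _ ≤ r := hrs
  have hts : p * s / q ≤ s := by
    rw [div_le_iff₀ hq0]; nlinarith
  obtain ⟨T, c, hc, C, hC, hT⟩ := exists_T hr hr2 ht htr hts hs
  have hTc : Continuous T := by
    rw [continuous_iff_continuousAt]
    intro g
    rw [ContinuousAt, tendsto_iff_norm_sub_tendsto_zero]
    have h1 : Tendsto (fun f : LSp r => (C * ‖f - g‖ ^ (p * s / q)) ^ (s⁻¹)) (𝓝 g) (𝓝 0) := by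
      have : ContinuousAt (fun f : LSp r => (C * ‖f - g‖ ^ (p * s / q)) ^ (s⁻¹)) g := by
        refine ContinuousAt.rpow_const (continuousAt_const.mul
          (ContinuousAt.rpow_const (by fun_prop) (Or.inr ht.le))) (Or.inr (by positivity))
      have h2 := this.tendsto
      simpa [Real.zero_rpow ht.ne', Real.zero_rpow (inv_ne_zero hs0.ne')] using h2
    refine squeeze_zero (fun _ => norm_nonneg _) (fun f => ?_) h1
    rw [Real.le_rpow_inv_iff_of_pos (norm_nonneg _) (by positivity) hs0]
    exact (hT f g).2
  have hb : ∀ f g, c ^ (q / s) * ‖f - g‖ ^ p ≤ ‖T f - T g‖ ^ q ∧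
      ‖T f - T g‖ ^ q ≤ C ^ (q / s) * ‖f - g‖ ^ p := by
    intro f g
    have e1 : ‖T f - T g‖ ^ q = (‖T f - T g‖ ^ s) ^ (q / s) := by
      rw [← Real.rpow_mul (norm_nonneg _)]; congr 1; field_simp
    have e2 : ∀ k : ℝ, 0 < k → k ^ (q / s) * ‖f - g‖ ^ p = (k * ‖f - g‖ ^ (p * s / q)) ^ (q / s) := by
      intro k hk
      rw [Real.mul_rpow hk.le (by positivity), ← Real.rpow_mul (norm_nonneg _)]
      congr 2; field_simp
    rw [e1, e2 c hc, e2 C hC]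
    exact ⟨Real.rpow_le_rpow (by positivity) (hT f g).1 (by positivity),
      Real.rpow_le_rpow (by positivity) (hT f g).2 (by positivity)⟩
  refine ⟨fun x n => T (x n), ?_, fun x y => ?_⟩
  · exact measurable_pi_iff.2 fun n => hTc.measurable.comp (measurable_pi_apply n)
  · constructor
    · intro h
      exact Summable.of_nonneg_of_le (fun n => by positivity) (fun n => (hb (x n) (y n)).2)
        (Summable.mul_left (C ^ (q / s)) h)
    · intro h
      have hcq : 0 < c ^ (q / s) := by positivity
      refine (summable_mul_left_iff hcq.ne').1 (Summable.of_nonneg_of_le (fun n => by positivity)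
        (fun n => (hb (x n) (y n)).1) h)

theorem ELr_reducible_ELs_iff (r s p q : ℝ) (hr : 1 ≤ r) (hr2 : r ≤ 2)
    (hs : 1 ≤ s) (hs2 : s ≤ 2) (hp : 1 ≤ p) (hq : 1 ≤ q) (hsq : s ≤ q)
    [Fact (1 ≤ ENNReal.ofReal r)] [Fact (1 ≤ ENNReal.ofReal s)] :
    BorelReducible (ESum (LSp r) p) (ESum (LSp s) q) ↔ (p ≤ q ∧ s/q ≤ r/p) := by
  exact ⟨fun h => ⟨nec_p hp hq h, nec_r hr hs hs2 hp hq hsq h⟩,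
    fun h => suff hr hr2 hs hp hq h.1 h.2⟩
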